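/- arXiv:1504.03850 — 13 statements merged into one kernel-verified Lean document; each statement's English description precedes it below -/
import Mathlib

section
/- Let the data (v_1, …, v_m; 𝓙) be a simplicial complete fan in ℝ^n with m = n + r ray generators, and let 𝓘 = { {1,…,m} \ J : J ∈ 𝓙 }. Then for every I ∈ 𝓘 and every index j ∈ {1,…,m} with j ∉ I there exists a unique k ∈ I such that (I \ {k}) ∪ {j} ∈ 𝓘. -/
open Finset

/-- The cone generated by the vectors `v i`, `i ∈ S`: all nonnegative linear combinations. -/
def coneOf {m d : ℕ} (v : Fin m → (Fin d → ℝ)) (S : Finset (Fin m)) : Set (Fin d → ℝ) :=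
  {x | ∃ c : Fin m → ℝ, (∀ i, 0 ≤ c i) ∧ (∀ i ∉ S, c i = 0) ∧ x = ∑ i, c i • v i}

/-- The data of a simplicial complete fan in ℝ^n with `m` ray generators `v i` and
collection `𝓙` of maximal cones (as `n`-element index sets). -/
def IsSimplicialCompleteFan {n m : ℕ} (v : Fin m → (Fin n → ℝ))
    (𝓙 : Set (Finset (Fin m))) : Prop :=
  (∀ i, v i ≠ 0) ∧
  (∀ i j : Fin m, i ≠ j → ∀ t : ℝ, 0 ≤ t → v i ≠ t • v j) ∧
  𝓙.Nonempty ∧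
  (∀ J ∈ 𝓙, J.card = n) ∧
  (∀ i : Fin m, ∃ J ∈ 𝓙, i ∈ J) ∧
  (∀ J ∈ 𝓙, LinearIndependent ℝ (fun j : J => v j)) ∧
  (∀ J ∈ 𝓙, ∀ J' ∈ 𝓙, coneOf v J ∩ coneOf v J' = coneOf v (J ∩ J')) ∧
  (⋃ J ∈ 𝓙, coneOf v J) = Set.univ

lemma linearCombination_mem_coneOf {m d : ℕ} (v : Fin m → (Fin d → ℝ)) {S : Finset (Fin m)}
    {c : Fin m → ℝ} (hc : ∀ i, 0 ≤ c i) (hS : ∀ i ∉ S, c i = 0) :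
    Fintype.linearCombination ℝ v c ∈ coneOf v S :=
  ⟨c, hc, hS, Fintype.linearCombination_apply ℝ v c⟩

lemma eq_of_linearCombination_eq {m d : ℕ} {v : Fin m → (Fin d → ℝ)} {J : Finset (Fin m)}
    (hJ : LinearIndependent ℝ (fun j : J => v j)) {c e : Fin m → ℝ}
    (hc : ∀ i ∉ J, c i = 0) (he : ∀ i ∉ J, e i = 0)
    (h : Fintype.linearCombination ℝ v c = Fintype.linearCombination ℝ v e) : c = e := by
  have hsum : ∑ i ∈ J, (c i - e i) • v i = 0 := by
    rw [Finset.sum_subset (Finset.subset_univ J)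
      (fun i _ hi => by rw [hc i hi, he i hi, sub_self, zero_smul])]
    simp only [Fintype.linearCombination_apply] at h
    simp only [sub_smul, Finset.sum_sub_distrib, h, sub_self]
  have hzero := Fintype.linearIndependent_iff.1 hJ (fun i => c i - e i)
    (by rw [← hsum, ← Finset.sum_coe_sort J])
  funext i
  by_cases hi : i ∈ J
  · exact sub_eq_zero.1 (hzero ⟨i, hi⟩)
  · rw [hc i hi, he i hi]

lemma exists_linearCombination_eq {m d : ℕ} {v : Fin m → (Fin d → ℝ)} {J : Finset (Fin m)}
    (hJ : LinearIndependent ℝ (fun j : J => v j)) (hcard : J.card = d) (x : Fin d → ℝ) :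
    ∃ c : Fin m → ℝ, (∀ i ∉ J, c i = 0) ∧ Fintype.linearCombination ℝ v c = x := by
  have hspan := hJ.span_eq_top_of_card_eq_finrank' (by simp [hcard])
  have hx : x ∈ Submodule.span ℝ (Set.range fun j : J => v j) := by rw [hspan]; trivial
  obtain ⟨g, rfl⟩ := (Submodule.mem_span_range_iff_exists_fun ℝ).1 hx
  refine ⟨fun i => if h : i ∈ J then g ⟨i, h⟩ else 0, fun i hi => by simp [hi], ?_⟩
  rw [Fintype.linearCombination_apply,
    ← Finset.sum_subset (Finset.subset_univ J) (fun i _ hi => by simp [hi]),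
    ← Finset.sum_coe_sort J]
  exact Finset.sum_congr rfl fun i _ => by simp

/-- Two distinct cones of a fan sharing the facet `W` cannot lie on the same side of it. -/
lemma not_same_side_of_cone_inter {m d : ℕ} {v : Fin m → (Fin d → ℝ)} {W : Finset (Fin m)}
    {k l : Fin m} (hk : k ∉ W) (hkl : k ≠ l)
    (hli : LinearIndependent ℝ (fun j : (insert k W : Finset (Fin m)) => v j))
    (hinter : coneOf v (insert k W) ∩ coneOf v (insert l W) =
      coneOf v (insert k W ∩ insert l W))
    {p q : ℝ} (hp : 0 < p) (hq : 0 < q) {b : Fin m → ℝ} (hb : ∀ i ∉ W, b i = 0)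
    (h : p • v k = q • v l + Fintype.linearCombination ℝ v b) : False := by
  set u : Fin m → ℝ := fun i => if i ∈ W then ∑ j, |b j| else 0 with hu
  have hM : ∀ i, |b i| ≤ ∑ j, |b j| := fun i =>
    Finset.single_le_sum (f := fun j => |b j|) (fun _ _ => abs_nonneg _) (Finset.mem_univ i)
  have hu0 : ∀ i, 0 ≤ u i := fun i => by
    simp only [hu]; split_ifs
    · exact (abs_nonneg _).trans (hM i)
    · exact le_rfl
  have hub : ∀ i, 0 ≤ b i + u i := fun i => by
    by_cases hi : i ∈ W
    · simp only [hu, hi, if_true]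
      linarith [neg_abs_le (b i), hM i]
    · simp [hu, hi, hb i hi]
  have hsingle : ∀ (a : Fin m) {t : ℝ}, 0 < t → ∀ i, 0 ≤ (Pi.single a t : Fin m → ℝ) i :=
    fun a t ht i => (Pi.single_nonneg.2 ht.le : (0 : Fin m → ℝ) ≤ Pi.single a t) i
  have hk_supp : ∀ i ∉ insert k W, (Pi.single k p + u : Fin m → ℝ) i = 0 := fun i hi => by
    rw [Finset.mem_insert, not_or] at hi
    simp [hu, hi.1, hi.2]
  have hl_supp : ∀ i ∉ insert l W, (Pi.single l q + (b + u) : Fin m → ℝ) i = 0 := fun i hi => by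
    rw [Finset.mem_insert, not_or] at hi
    simp [hu, hi.1, hi.2, hb i hi.2]
  have h₁ := linearCombination_mem_coneOf v
    (fun i => add_nonneg (hsingle k hp i) (hu0 i)) hk_supp
  have h₂ := linearCombination_mem_coneOf v
    (fun i => add_nonneg (hsingle l hq i) (hub i)) hl_supp
  have heq : Fintype.linearCombination ℝ v (Pi.single l q + (b + u)) =
      Fintype.linearCombination ℝ v (Pi.single k p + u) := by
    simp only [map_add, Fintype.linearCombination_apply_single, h, add_assoc]
  change Fintype.linearCombination ℝ v (Pi.single k p + u) ∈ _ at h₁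
  change Fintype.linearCombination ℝ v (Pi.single l q + (b + u)) ∈ _ at h₂
  rw [heq] at h₂
  have h₃ := hinter ▸ Set.mem_inter h₁ h₂
  obtain ⟨c, -, hc, hxc⟩ := h₃
  rw [← Fintype.linearCombination_apply ℝ v c] at hxc
  have := congrFun (eq_of_linearCombination_eq hli hk_supp
    (fun i hi => hc i fun hi' => hi (Finset.mem_inter.1 hi').1) hxc) k
  rw [hc k (by simp [hk, hkl])] at this
  simp [hu, hk] at this
  exact hp.ne' this

namespace IsSimplicialCompleteFan

variable {n m : ℕ} {v : Fin m → (Fin n → ℝ)} {𝓙 : Set (Finset (Fin m))}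

/-- Every facet of a maximal cone is a facet of another maximal cone. -/
lemma exists_adjacent (hfan : IsSimplicialCompleteFan v 𝓙) {J : Finset (Fin m)} (hJ : J ∈ 𝓙)
    {j : Fin m} (hj : j ∈ J) : ∃ k ∉ J, insert k (J.erase j) ∈ 𝓙 := by
  obtain ⟨-, -, -, hcard, -, hli, hinter, hcover⟩ := hfan
  set L := Fintype.linearCombination ℝ v with hL
  set u : Fin m → ℝ := fun i => if i ∈ J.erase j then 1 else 0 with hu
  have hu_supp : ∀ i ∉ J, u i = 0 := fun i hi => by simp [hu, hi]
  have hLj : L (Pi.single j 1) = v j := by simp [hL, Fintype.linearCombination_apply_single]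
  obtain ⟨J', hJ', hfreq⟩ :
      ∃ J' ∈ 𝓙, ∃ᶠ ε : ℝ in nhdsWithin 0 (Set.Ioi 0), L u - ε • v j ∈ coneOf v J' := by
    by_contra! hcon
    have hall : ∀ᶠ ε : ℝ in nhdsWithin 0 (Set.Ioi 0),
        ∀ J' : Finset (Fin m), J' ∈ 𝓙 → L u - ε • v j ∉ coneOf v J' := by
      refine Filter.eventually_all.2 fun J' => ?_
      by_cases hJ' : J' ∈ 𝓙
      · filter_upwards [hcon J' hJ'] with ε hε _ using hε
      · exact Filter.Eventually.of_forall fun ε h => absurd h hJ'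
    obtain ⟨ε, hε⟩ := hall.exists
    have hmem : L u - ε • v j ∈ ⋃ J ∈ 𝓙, coneOf v J := hcover ▸ Set.mem_univ _
    simp only [Set.mem_iUnion] at hmem
    obtain ⟨J', hJ', h⟩ := hmem
    exact hε J' hJ' h
  have hne : J' ≠ J := by
    rintro rfl
    obtain ⟨ε, ⟨c, hc0, hc, hx⟩, hε⟩ := (hfreq.and_eventually self_mem_nhdsWithin).exists
    rw [← Fintype.linearCombination_apply ℝ v c, ← hLj, ← map_smul, ← map_sub] at hx
    have := congrFun (eq_of_linearCombination_eq (hli J' hJ) (fun i hi => by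
      have hij : i ≠ j := fun h => hi (h ▸ hj)
      simp [hu_supp i hi, hij]) hc hx) j
    simp [hu] at this
    have hε' : 0 < ε := hε
    linarith [hc0 j]
  obtain ⟨d, hd, hLd⟩ := exists_linearCombination_eq (hli J' hJ') (hcard J' hJ') (L u)
  obtain ⟨e, he, hLe⟩ := exists_linearCombination_eq (hli J' hJ') (hcard J' hJ') (v j)
  have hd0 : ∀ i, 0 ≤ d i := fun i => by
    by_contra! hneg
    have htend : Filter.Tendsto (fun ε : ℝ => d i - ε * e i) (nhdsWithin 0 (Set.Ioi 0))
        (nhds (d i)) := by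
      have : Continuous fun ε : ℝ => d i - ε * e i := by fun_prop
      simpa using (this.tendsto 0).mono_left nhdsWithin_le_nhds
    obtain ⟨ε, ⟨c, hc0, hc, hx⟩, hε⟩ :=
      (hfreq.and_eventually (htend.eventually_lt_const hneg)).exists
    rw [← Fintype.linearCombination_apply ℝ v c, ← hLd, ← hLe, ← map_smul, ← map_sub] at hx
    have := congrFun (eq_of_linearCombination_eq (hli J' hJ')
      (fun i hi => by simp [hd i hi, he i hi]) hc hx) i
    simp at this
    linarith [hc0 i]
  have hsub : J.erase j ⊆ J' := fun i hi => by
    have h₁ : L u ∈ coneOf v J := linearCombination_mem_coneOf v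
      (fun i => by simp only [hu]; split_ifs <;> norm_num) hu_supp
    have h₂ : L u ∈ coneOf v J' := hLd ▸ linearCombination_mem_coneOf v hd0 hd
    obtain ⟨c, -, hc, hx⟩ := hinter J hJ J' hJ' ▸ Set.mem_inter h₁ h₂
    rw [← Fintype.linearCombination_apply ℝ v c] at hx
    have := congrFun (eq_of_linearCombination_eq (hli J hJ) hu_supp
      (fun i hi => hc i fun h => hi (Finset.mem_inter.1 h).1) hx) i
    by_contra hi'
    rw [hc i fun h => hi' (Finset.mem_inter.1 h).2] at this
    simp only [hu, hi, if_true] at this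
    exact one_ne_zero this
  obtain ⟨k, hk, rfl⟩ := Finset.exists_eq_insert_iff.2
    ⟨hsub, by rw [Finset.card_erase_add_one hj, hcard J hJ, hcard J' hJ']⟩
  refine ⟨k, fun hkJ => ?_, hJ'⟩
  have hkj : k = j := by
    by_contra h
    exact hk (Finset.mem_erase.2 ⟨h, hkJ⟩)
  exact hne (by rw [hkj, Finset.insert_erase hj])

/-- A facet of a maximal cone lies in at most one other maximal cone. -/
lemma adjacent_unique (hfan : IsSimplicialCompleteFan v 𝓙) {J : Finset (Fin m)} (hJ : J ∈ 𝓙)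
    {j : Fin m} (hj : j ∈ J) {k l : Fin m} (hk : k ∉ J) (hl : l ∉ J)
    (hkJ : insert k (J.erase j) ∈ 𝓙) (hlJ : insert l (J.erase j) ∈ 𝓙) : k = l := by
  obtain ⟨-, -, -, hcard, -, hli, hinter, -⟩ := hfan
  set L := Fintype.linearCombination ℝ v with hL
  have hins : insert j (J.erase j) = J := Finset.insert_erase hj
  have key : ∀ x ∉ J, insert x (J.erase j) ∈ 𝓙 → ∃ (a : ℝ) (b : Fin m → ℝ), a < 0 ∧
      (∀ i ∉ J.erase j, b i = 0) ∧ v x = a • v j + L b := fun x hx hxJ => by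
    have hxW : x ∉ J.erase j := fun h => hx (Finset.mem_of_mem_erase h)
    have hxj : x ≠ j := fun h => hx (h ▸ hj)
    obtain ⟨c, hc, hLc⟩ := exists_linearCombination_eq (hli J hJ) (hcard J hJ) (v x)
    have hb : ∀ i ∉ J.erase j, (c - Pi.single j (c j) : Fin m → ℝ) i = 0 := fun i hi => by
      by_cases hij : i = j
      · simp [hij]
      · have : i ∉ J := fun h => hi (Finset.mem_erase.2 ⟨hij, h⟩)
        simp [hij, hc i this]
    have heq : v x = c j • v j + L (c - Pi.single j (c j)) := by
      rw [map_sub, hL, Fintype.linearCombination_apply_single, hLc]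
      abel
    refine ⟨c j, _, ?_, hb, heq⟩
    rcases lt_trichotomy (c j) 0 with h | h | h
    · exact h
    · exfalso
      have hLx : L (Pi.single x 1) = L (c - Pi.single j (c j)) := by
        rw [hL, Fintype.linearCombination_apply_single, one_smul, ← hL, heq, h]
        simp
      have := congrFun (eq_of_linearCombination_eq (hli _ hxJ) (fun i hi => by
        have : i ≠ x := fun h => hi (h ▸ Finset.mem_insert_self _ _)
        simp [this]) (fun i hi => hb i fun h => hi (Finset.mem_insert_of_mem h)) hLx) x
      rw [hb x hxW] at this
      simp at this
    · refine (not_same_side_of_cone_inter hxW hxj (hli _ hxJ) ?_ one_pos h hb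
        (by rw [one_smul]; exact heq)).elim
      exact hinter _ hxJ _ (hins.symm ▸ hJ)
  obtain ⟨a, b, ha, hb, hk'⟩ := key k hk hkJ
  obtain ⟨a', b', ha', hb', hl'⟩ := key l hl hlJ
  by_contra hkl
  refine not_same_side_of_cone_inter (fun h => hk (Finset.mem_of_mem_erase h)) hkl (hli _ hkJ)
    (hinter _ hkJ _ hlJ) (neg_pos.2 ha') (neg_pos.2 ha) (b := a • b' - a' • b)
    (fun i hi => by simp [hb i hi, hb' i hi]) ?_
  rw [← hL, map_sub, map_smul, map_smul, hk', hl']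
  module

end IsSimplicialCompleteFan

theorem stmt_0 {n r : ℕ} (hn : 1 ≤ n) (hr : 1 ≤ r) {m : ℕ} (hm : m = n + r)
    (v : Fin m → (Fin n → ℝ)) (𝓙 : Set (Finset (Fin m)))
    (hfan : IsSimplicialCompleteFan v 𝓙)
    (𝓘 : Set (Finset (Fin m))) (h𝓘 : 𝓘 = {I | ∃ J ∈ 𝓙, I = Jᶜ})
    (I : Finset (Fin m)) (hI : I ∈ 𝓘) (j : Fin m) (hj : j ∉ I) :
    ∃! k : Fin m, k ∈ I ∧ insert j (I.erase k) ∈ 𝓘 := by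
  subst h𝓘
  obtain ⟨J, hJ, rfl⟩ := hI
  have hjJ : j ∈ J := by simpa using hj
  have hmem : ∀ k ∉ J, (insert j (Jᶜ.erase k) ∈ {I | ∃ J ∈ 𝓙, I = Jᶜ} ↔
      insert k (J.erase j) ∈ 𝓙) := fun k hk => by
    have hkj : k ≠ j := fun h => hk (h ▸ hjJ)
    have hcompl : insert j (Jᶜ.erase k) = (insert k (J.erase j))ᶜ := by
      ext i
      simp only [Finset.mem_insert, Finset.mem_erase, Finset.mem_compl]
      grind
    simp only [hcompl, Set.mem_ofPred_eq, compl_inj_iff, exists_eq_right']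
  obtain ⟨k, hk, hkJ⟩ := hfan.exists_adjacent hJ hjJ
  refine ⟨k, ⟨by simpa using hk, (hmem k hk).2 hkJ⟩, ?_⟩
  rintro l ⟨hl, hlJ⟩
  rw [Finset.mem_compl] at hl
  exact hfan.adjacent_unique hJ hjJ hl hk ((hmem l hl).1 hlJ) hkJ
end

section
/- Let the data (v_1, …, v_m; 𝓙) be a simplicial complete fan in ℝ^n with m = n + r ray generators and let Q be a Gale dual matrix of V with columns q_1, …, q_m ∈ ℝ^r. Let I ∈ 𝓘, let j ∉ I, and let k ∈ I be such that I' = (I \ {k}) ∪ {j} ∈ 𝓘. Then q_j and q_k lie strictly on the same side of the hyperplane of ℝ^r spanned by {q_i : i ∈ I \ {k}}; precisely, there exists w ∈ ℝ^r such that w·q_i = 0 for every i ∈ I \ {k}, while w·q_j > 0 and w·q_k > 0. -/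
open Finset Matrix

/-- A linearly independent family of `n` vectors in `ℝⁿ` expands every vector. -/
theorem exists_expansion_of_linearIndependent {n m : ℕ} (v : Fin m → (Fin n → ℝ))
    {J : Finset (Fin m)} (hJ : LinearIndependent ℝ (fun j : J => v j)) (hcard : J.card = n)
    (y : Fin n → ℝ) :
    ∃ c : Fin m → ℝ, (∀ i ∉ J, c i = 0) ∧ ∑ i, c i • v i = y := by
  have hspan := hJ.span_eq_top_of_card_eq_finrank' (by simp [hcard])
  have hy : y ∈ Submodule.span ℝ (Set.range fun j : J => v j) := hspan ▸ Submodule.mem_top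
  obtain ⟨c, hc⟩ := (Submodule.mem_span_range_iff_exists_fun ℝ).1 hy
  refine ⟨fun i => if hi : i ∈ J then c ⟨i, hi⟩ else 0, fun i hi => dif_neg hi, ?_⟩
  rw [← hc, ← Finset.sum_subset J.subset_univ fun i _ hi => by simp [hi], ← Finset.sum_coe_sort]
  simp

/-- Coefficients supported on a linearly independent subfamily are unique. -/
theorem eq_of_sum_smul_eq_of_linearIndependent {n m : ℕ} (v : Fin m → (Fin n → ℝ))
    {J : Finset (Fin m)} (hJ : LinearIndependent ℝ (fun j : J => v j)) {c d : Fin m → ℝ}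
    (hc : ∀ i ∉ J, c i = 0) (hd : ∀ i ∉ J, d i = 0)
    (h : ∑ i, c i • v i = ∑ i, d i • v i) (i : Fin m) : c i = d i := by
  by_cases hi : i ∈ J
  · have hz : ∑ i ∈ J, (c i - d i) • v i = 0 := by
      rw [Finset.sum_subset J.subset_univ (fun i _ hi => by simp [hc i hi, hd i hi])]
      simp [sub_smul, h]
    exact sub_eq_zero.1 (linearIndepOn_finset_iff.1 hJ _ hz i hi)
  · rw [hc i hi, hd i hi]

/-- In a simplicial complete fan, the generators of two adjacent maximal cones that are not
shared lie on opposite sides of the common facet. -/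
theorem IsSimplicialCompleteFan.coeff_neg_of_adjacent {n m : ℕ} {v : Fin m → (Fin n → ℝ)}
    {𝓙 : Set (Finset (Fin m))} (hfan : IsSimplicialCompleteFan v 𝓙)
    {J J' : Finset (Fin m)} (hJ : J ∈ 𝓙) (hJ' : J' ∈ 𝓙) {j k : Fin m}
    (hkJ : k ∉ J) (hkJ' : k ∈ J') (hsub : J.erase j ⊆ J')
    {c : Fin m → ℝ} (hc : ∀ i ∉ J, c i = 0) (hsum : ∑ i, c i • v i = v k) : c j < 0 := by
  obtain ⟨-, -, -, -, -, hindep, hinter, -⟩ := hfan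
  by_contra! hcj
  -- `v k` pushed far into the common facet lies in both cones but not in the facet
  set t : Fin m → ℝ := fun i => if i ∈ J.erase j then |c i| else 0 with ht
  have ht0 : ∀ i, 0 ≤ t i := fun i => by simp only [ht]; split_ifs <;> positivity
  have htJ : ∀ i ∉ J.erase j, t i = 0 := fun i hi => if_neg hi
  have hk : ∑ i, (Pi.single k 1 : Fin m → ℝ) i • v i = v k := by
    simp [Pi.single_apply, ite_smul]
  have hk' : ∀ i ∉ J', t i + (Pi.single k 1 : Fin m → ℝ) i = 0 := fun i hi => by
    rw [htJ i fun h => hi (hsub h), Pi.single_eq_of_ne (ne_of_mem_of_not_mem hkJ' hi).symm, add_zero]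
  have hmem : ∑ i, t i • v i + v k ∈ coneOf v J ∩ coneOf v J' := by
    constructor
    · refine ⟨fun i => t i + c i, fun i => ?_, fun i hi => ?_, ?_⟩
      · by_cases hi : i ∈ J.erase j
        · simp only [ht, if_pos hi]
          linarith [neg_abs_le (c i)]
        · simp only [htJ i hi, zero_add]
          by_cases hij : i = j
          · exact hij ▸ hcj
          · rw [hc i fun h => hi (Finset.mem_erase.2 ⟨hij, h⟩)]
      · simp only [hc i hi, htJ i fun h => hi (Finset.mem_of_mem_erase h), add_zero]
      · simp [add_smul, Finset.sum_add_distrib, hsum]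
    · refine ⟨fun i => t i + (Pi.single k 1 : Fin m → ℝ) i, fun i => ?_, hk', ?_⟩
      · have : 0 ≤ (Pi.single k 1 : Fin m → ℝ) i := by
          rw [Pi.single_apply]; split_ifs <;> norm_num
        exact add_nonneg (ht0 i) this
      · simp only [add_smul, Finset.sum_add_distrib, hk]
  rw [hinter J hJ J' hJ'] at hmem
  obtain ⟨d, -, hd, hdsum⟩ := hmem
  have heq := eq_of_sum_smul_eq_of_linearIndependent v (hindep J' hJ') hk'
    (fun i hi => hd i fun h => hi (Finset.mem_inter.1 h).2)
    (by rw [← hdsum]; simp only [add_smul, Finset.sum_add_distrib, hk]) k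
  rw [hd k fun h => hkJ (Finset.mem_inter.1 h).1,
    htJ k fun h => hkJ (Finset.mem_of_mem_erase h)] at heq
  simp at heq

/-- If `Q` is a Gale dual matrix of `V`, then every linear relation among the columns of `V`
is a combination of the rows of `Q`. -/
theorem exists_vecMul_eq_of_mulVec_eq_zero {n r m : ℕ} (hm : m = n + r)
    {V : Matrix (Fin n) (Fin m) ℝ} {Q : Matrix (Fin r) (Fin m) ℝ}
    (hV : Function.Surjective V.mulVecLin) (hQrank : Q.rank = r) (hQV : Q * Vᵀ = 0)
    {x : Fin m → ℝ} (hx : V *ᵥ x = 0) : ∃ w : Fin r → ℝ, w ᵥ* Q = x := by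
  have hle : LinearMap.range Qᵀ.mulVecLin ≤ LinearMap.ker V.mulVecLin := by
    rintro _ ⟨w, rfl⟩
    have hVQ : V * Qᵀ = 0 := by simpa using congrArg Matrix.transpose hQV
    rw [LinearMap.mem_ker, Matrix.mulVecLin_apply, Matrix.mulVecLin_apply, Matrix.mulVec_mulVec,
      hVQ, Matrix.zero_mulVec]
  have hker := V.mulVecLin.finrank_range_add_finrank_ker
  rw [LinearMap.range_eq_top.2 hV, finrank_top] at hker
  simp only [Module.finrank_fin_fun] at hker
  have hrange : Module.finrank ℝ (LinearMap.range Qᵀ.mulVecLin) = r :=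
    (Matrix.rank_transpose Q).trans hQrank
  have heq := Submodule.eq_of_le_of_finrank_eq hle (by omega)
  have hxr : x ∈ LinearMap.range Qᵀ.mulVecLin := heq ▸ LinearMap.mem_ker.2 hx
  obtain ⟨w, rfl⟩ := hxr
  exact ⟨w, (Matrix.mulVec_transpose Q w).symm⟩

theorem stmt_2 {n r : ℕ} (hn : 1 ≤ n) (hr : 1 ≤ r) {m : ℕ} (hm : m = n + r)
    (V : Matrix (Fin n) (Fin m) ℝ) (Q : Matrix (Fin r) (Fin m) ℝ)
    (𝓙 : Set (Finset (Fin m)))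
    (hfan : IsSimplicialCompleteFan (fun i a => V a i) 𝓙)
    (hQrank : Q.rank = r) (hQV : Q * Vᵀ = 0)
    (𝓘 : Set (Finset (Fin m))) (h𝓘 : 𝓘 = {I | ∃ J ∈ 𝓙, I = Jᶜ})
    (I : Finset (Fin m)) (hI : I ∈ 𝓘) (j k : Fin m) (hj : j ∉ I) (hk : k ∈ I)
    (hI' : insert j (I.erase k) ∈ 𝓘) :
    ∃ w : Fin r → ℝ,
      (∀ i ∈ I.erase k, w ⬝ᵥ (fun a => Q a i) = 0) ∧
      0 < w ⬝ᵥ (fun a => Q a j) ∧ 0 < w ⬝ᵥ (fun a => Q a k) := by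
  subst h𝓘
  obtain ⟨J, hJ, rfl⟩ := hI
  obtain ⟨J', hJ', hJJ'⟩ := hI'
  have hmem : ∀ i, i ∈ J' ↔ i ≠ j ∧ (i = k ∨ i ∈ J) := fun i => by
    have := congrArg (i ∈ ·) hJJ'
    simp only [Finset.mem_insert, Finset.mem_erase, Finset.mem_compl, eq_iff_iff] at this
    tauto
  rw [Finset.mem_compl] at hk
  rw [Finset.mem_compl, not_not] at hj
  have hjk : j ≠ k := fun h => hk (h ▸ hj)
  have hmulVec : ∀ c : Fin m → ℝ, V *ᵥ c = ∑ i, c i • fun a => V a i := fun c => by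
    ext a
    simp [Matrix.mulVec, dotProduct, mul_comm]
  have hexp := exists_expansion_of_linearIndependent (fun i a => V a i)
    (hfan.2.2.2.2.2.1 J hJ) (hfan.2.2.2.1 J hJ)
  obtain ⟨c, hc, hsum⟩ := hexp fun a => V a k
  have hneg : c j < 0 := hfan.coeff_neg_of_adjacent hJ hJ' hk ((hmem k).2 ⟨hjk.symm, .inl rfl⟩)
    (fun i hi => (hmem i).2 ⟨(Finset.mem_erase.1 hi).1, .inr (Finset.mem_erase.1 hi).2⟩) hc hsum
  have hsurj : Function.Surjective V.mulVecLin := fun y => by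
    obtain ⟨d, -, hd⟩ := hexp y
    exact ⟨d, (hmulVec d).trans hd⟩
  obtain ⟨w, hw⟩ := exists_vecMul_eq_of_mulVec_eq_zero hm hsurj hQrank hQV
    (x := Pi.single k 1 - c) (by
      rw [Matrix.mulVec_sub, hmulVec c, hsum, Matrix.mulVec_single_one]
      exact sub_self _)
  have hwi : ∀ i, w ⬝ᵥ (fun a => Q a i) = (Pi.single k 1 : Fin m → ℝ) i - c i :=
    fun i => congrFun hw i
  refine ⟨w, fun i hi => ?_, ?_, ?_⟩
  · rw [Finset.mem_erase, Finset.mem_compl] at hi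
    rw [hwi, hc i hi.2, Pi.single_eq_of_ne hi.1, sub_zero]
  · rw [hwi, Pi.single_eq_of_ne hjk]
    linarith
  · rw [hwi, hc k hk, Pi.single_eq_same]
    norm_num
end

section
/- Let r = 2 and let the data (v_1, …, v_m; 𝓙) be a simplicial complete fan in ℝ^n with m = n + 2 ray generators, with 𝓘 the collection of complements of members of 𝓙. If a, b, c ∈ {1,…,m} are pairwise distinct indices with {a, b} ∈ 𝓘, then exactly one of the two sets {a, c} and {b, c} belongs to 𝓘. -/
open Finset Matrix

/-- The coordinate functionals of a basis of `ℝ^d` indexed by a finite set `J` of labels,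
extended by zero to all labels. -/
lemma exists_coordinates {m d : ℕ} (v : Fin m → (Fin d → ℝ)) (J : Finset (Fin m))
    (hcard : J.card = d) (hli : LinearIndependent ℝ (fun j : J => v j)) :
    ∃ ψ : Fin m → ((Fin d → ℝ) →ₗ[ℝ] ℝ), (∀ x, ∀ i ∉ J, ψ i x = 0) ∧
      (∀ x, x = ∑ i, ψ i x • v i) ∧
      ∀ w : Fin m → ℝ, (∀ i ∉ J, w i = 0) → ∀ i, ψ i (∑ j, w j • v j) = w i := by
  classical
  have hspan := hli.span_eq_top_of_card_eq_finrank' (by simp [hcard])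
  let B := Module.Basis.mk hli hspan.ge
  let ψ : Fin m → ((Fin d → ℝ) →ₗ[ℝ] ℝ) := fun i => if h : i ∈ J then B.coord ⟨i, h⟩ else 0
  have hsum : ∀ w : Fin m → ℝ, (∀ i ∉ J, w i = 0) →
      ∑ j, w j • v j = ∑ j : J, w j • v j := by
    intro w hw
    rw [Finset.sum_coe_sort J (fun j => w j • v j)]
    refine (Finset.sum_subset (Finset.subset_univ J) fun i _ hi => ?_).symm
    rw [hw i hi, zero_smul]
  have hzero : ∀ x, ∀ i ∉ J, ψ i x = 0 := fun x i hi => by simp [ψ, hi]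
  refine ⟨ψ, hzero, fun x => ?_, fun w hw i => ?_⟩
  · rw [hsum _ (hzero x)]
    conv_lhs => rw [← B.sum_repr x]
    exact Finset.sum_congr rfl fun j _ => by simp [ψ, B]
  · by_cases hi : i ∈ J
    · have hB : ∑ j : J, w j • v j = ∑ j : J, w j • B j :=
        Finset.sum_congr rfl fun j _ => by simp [B]
      simp only [ψ, hi, dite_true]
      rw [hsum w hw, hB, Module.Basis.coord_apply, B.repr_sum_self (fun j : J => w j)]
    · rw [hzero _ i hi, hw i hi]

/-- A linear functional vanishing on the rays in `F` vanishes on the cone over `F`. -/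
lemma map_eq_zero_of_mem_coneOf {m d : ℕ} {v : Fin m → (Fin d → ℝ)} {F : Finset (Fin m)}
    {φ : (Fin d → ℝ) →ₗ[ℝ] ℝ} (hφ : ∀ i ∈ F, φ (v i) = 0) {x : Fin d → ℝ}
    (hx : x ∈ coneOf v F) : φ x = 0 := by
  obtain ⟨w, -, hw, rfl⟩ := hx
  rw [map_sum]
  refine Finset.sum_eq_zero fun i _ => ?_
  by_cases hi : i ∈ F
  · simp [hφ i hi]
  · simp [hw i hi]

/-- Two maximal cones sharing a facet lie on opposite sides of it. -/
lemma not_same_side {n m : ℕ} {v : Fin m → (Fin n → ℝ)} {𝓙 : Set (Finset (Fin m))}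
    (hfan : IsSimplicialCompleteFan v 𝓙) {F : Finset (Fin m)} {p q : Fin m}
    (hp : p ∉ F) (hq : q ∉ F) (hpq : p ≠ q) (hpF : insert p F ∈ 𝓙) (hqF : insert q F ∈ 𝓙)
    (φ : (Fin n → ℝ) →ₗ[ℝ] ℝ) (hφ : ∀ i ∈ F, φ (v i) = 0) (hφp : 0 < φ (v p))
    (hφq : 0 < φ (v q)) : False := by
  classical
  obtain ⟨-, -, -, hcard, -, hli, hint, -⟩ := hfan
  obtain ⟨ψ, hψ0, hψs, -⟩ := exists_coordinates v _ (hcard _ hqF) (hli _ hqF)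
  have hmap : φ (v p) = ψ q (v p) * φ (v q) := by
    conv_lhs => rw [hψs (v p)]
    rw [map_sum, Finset.sum_eq_single q]
    · simp
    · intro i _ hi
      by_cases hiF : i ∈ F
      · simp [hφ i hiF]
      · simp [hψ0 (v p) i (by simp [hi, hiF])]
    · simp
  have hpos : 0 < ψ q (v p) := by
    rw [hmap] at hφp
    exact pos_of_mul_pos_left hφp hφq.le
  let K : ℝ := ∑ i, |ψ i (v p)|
  have hK0 : 0 ≤ K := Finset.sum_nonneg fun i _ => abs_nonneg _
  have hKi : ∀ i, 0 ≤ ψ i (v p) + K := fun i => by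
    have h1 := Finset.single_le_sum (f := fun i => |ψ i (v p)|)
      (fun i _ => abs_nonneg _) (Finset.mem_univ i)
    have h2 := neg_abs_le (ψ i (v p))
    linarith
  let e : Fin m → ℝ := fun i => if i ∈ F then K else 0
  have he : ∀ i, 0 ≤ e i := fun i => by simp only [e]; split_ifs <;> simp [hK0]
  let y : Fin n → ℝ := v p + ∑ i, e i • v i
  have hy1 : y ∈ coneOf v (insert p F) := by
    refine ⟨fun i => (if i = p then 1 else 0) + e i, fun i => ?_, fun i hi => ?_, ?_⟩
    · have := he i
      beta_reduce
      split_ifs <;> linarith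
    · simp only [Finset.mem_insert, not_or] at hi
      simp [e, hi.1, hi.2]
    · simp [y, add_smul, Finset.sum_add_distrib, ite_smul]
  have hy2 : y ∈ coneOf v (insert q F) := by
    refine ⟨fun i => ψ i (v p) + e i, fun i => ?_, fun i hi => ?_, ?_⟩
    · by_cases hiF : i ∈ F
      · simpa [e, hiF] using hKi i
      · by_cases hiq : i = q
        · subst hiq
          simpa [e, hiF] using hpos.le
        · simp [e, hiF, hψ0 (v p) i (by simp [hiF, hiq])]
    · have h0 := hψ0 (v p) i hi
      simp only [Finset.mem_insert, not_or] at hi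
      simp [e, hi.2, h0]
    · simp only [add_smul, Finset.sum_add_distrib, y]
      rw [← hψs (v p)]
  have hy : y ∈ coneOf v (insert p F ∩ insert q F) := hint _ hpF _ hqF ▸ ⟨hy1, hy2⟩
  have hF : insert p F ∩ insert q F = F := by
    ext i
    simp only [Finset.mem_inter, Finset.mem_insert]
    constructor
    · rintro ⟨rfl | h, rfl | h'⟩
      exacts [absurd rfl hpq, h', h, h]
    · exact fun h => ⟨Or.inr h, Or.inr h⟩
  rw [hF] at hy
  have hzero := map_eq_zero_of_mem_coneOf hφ hy
  have he0 : φ (∑ i, e i • v i) = 0 := by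
    refine map_eq_zero_of_mem_coneOf hφ ⟨e, he, fun i hi => ?_, rfl⟩
    simp [e, hi]
  simp only [y, map_add, he0] at hzero
  linarith

/-- Every facet of a maximal cone of a complete fan lies in another maximal cone. -/
lemma exists_adjacent_cone {n m : ℕ} {v : Fin m → (Fin n → ℝ)} {𝓙 : Set (Finset (Fin m))}
    (hfan : IsSimplicialCompleteFan v 𝓙) {F : Finset (Fin m)} {c : Fin m}
    (hc : c ∉ F) (hcF : insert c F ∈ 𝓙) : ∃ J ∈ 𝓙, F ⊆ J ∧ c ∉ J := by
  classical
  obtain ⟨-, -, -, hcard, -, hli, hint, huniv⟩ := hfan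
  obtain ⟨ψ, hψ0, hψs, hψw⟩ := exists_coordinates v _ (hcard _ hcF) (hli _ hcF)
  let e : Fin m → ℝ := fun i => if i ∈ F then 1 else 0
  let x : Fin n → ℝ := ∑ i, e i • v i
  have he0 : ∀ i ∉ insert c F, e i = 0 := fun i hi => by
    simp only [Finset.mem_insert, not_or] at hi
    simp [e, hi.2]
  have hx : x ∈ coneOf v (insert c F) :=
    ⟨e, fun i => by simp only [e]; split_ifs <;> simp, he0, rfl⟩
  have hex : ∀ K : ℕ, ∃ J ∈ 𝓙, (K : ℝ) • x - v c ∈ coneOf v J := fun K => by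
    have h : (K : ℝ) • x - v c ∈ ⋃ J ∈ 𝓙, coneOf v J := huniv ▸ Set.mem_univ _
    simpa using h
  choose g hg hgx using hex
  obtain ⟨J, hJinf⟩ := Finite.exists_infinite_fiber g
  have hinf : (g ⁻¹' {J}).Infinite := Set.infinite_coe_iff.mp hJinf
  have hlarge : ∀ N : ℕ, ∃ K ≥ N, g K = J := fun N => by
    obtain ⟨K, hK, hNK⟩ := hinf.exists_gt N
    exact ⟨K, hNK.le, hK⟩
  obtain ⟨K₀, -, hK₀⟩ := hlarge 0
  have hJ : J ∈ 𝓙 := hK₀ ▸ hg K₀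
  obtain ⟨χ, hχ0, hχs, hχw⟩ := exists_coordinates v _ (hcard _ hJ) (hli _ hJ)
  have hχx : ∀ i, 0 ≤ χ i x := fun i => by
    by_contra! hneg
    obtain ⟨N, hN⟩ := exists_nat_gt (-χ i (v c) / -χ i x)
    obtain ⟨K, hK, hKJ⟩ := hlarge N
    have hmem := hgx K
    rw [hKJ] at hmem
    obtain ⟨w, hw, hw0, hwx⟩ := hmem
    have h1 : 0 ≤ χ i ((K : ℝ) • x - v c) := by rw [hwx, hχw w hw0]; exact hw i
    rw [map_sub, map_smul, smul_eq_mul] at h1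
    have h2 : (N : ℝ) ≤ K := by exact_mod_cast hK
    rw [div_lt_iff₀ (by linarith)] at hN
    nlinarith
  have hxJ : x ∈ coneOf v J := ⟨fun i => χ i x, hχx, hχ0 x, hχs x⟩
  have hxi : x ∈ coneOf v (insert c F ∩ J) := hint _ hcF _ hJ ▸ ⟨hx, hxJ⟩
  have hFJ : F ⊆ J := fun i hi => by
    by_contra hiJ
    obtain ⟨w, -, hw0, hwx⟩ := hxi
    have h1 : ψ i x = e i := hψw e he0 i
    have h2 : ψ i x = w i := by
      rw [hwx]
      exact hψw w (fun j hj => hw0 j fun h => hj (Finset.mem_inter.mp h).1) i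
    rw [hw0 i fun h => hiJ (Finset.mem_inter.mp h).2, h1] at h2
    simp [e, hi] at h2
  refine ⟨J, hJ, hFJ, fun hcJ => ?_⟩
  have hEq : insert c F = J := Finset.eq_of_subset_of_card_le
    (Finset.insert_subset hcJ hFJ) (by rw [hcard _ hJ, hcard _ hcF])
  have hmem := hgx K₀
  rw [hK₀, ← hEq] at hmem
  obtain ⟨w, hw, hw0, hwx⟩ := hmem
  have h1 : 0 ≤ ψ c ((K₀ : ℝ) • x - v c) := by rw [hwx, hψw w hw0]; exact hw c
  have h2 : ψ c x = 0 := (hψw e he0 c).trans (by simp [e, hc])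
  have h3 : ψ c (v c) = 1 := by
    have := hψw (fun i => if i = c then 1 else 0) (fun i hi => by
      simp only [Finset.mem_insert, not_or] at hi
      simp [hi.1]) c
    simpa [ite_smul] using this
  rw [map_sub, map_smul, h2, h3] at h1
  norm_num at h1

/-- A functional vanishing on a facet, but not on a maximal cone containing that facet,
vanishes on no further ray spanning a maximal cone with the facet. -/
lemma map_ray_ne_zero {n m : ℕ} {v : Fin m → (Fin n → ℝ)} {𝓙 : Set (Finset (Fin m))}
    (hfan : IsSimplicialCompleteFan v 𝓙) {F : Finset (Fin m)} {p : Fin m}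
    (hpF : insert p F ∈ 𝓙) {φ : (Fin n → ℝ) →ₗ[ℝ] ℝ} (hφ : ∀ i ∈ F, φ (v i) = 0)
    {y : Fin n → ℝ} (hy : φ y ≠ 0) : φ (v p) ≠ 0 := by
  classical
  obtain ⟨-, -, -, hcard, -, hli, -, -⟩ := hfan
  obtain ⟨ψ, hψ0, hψs, -⟩ := exists_coordinates v _ (hcard _ hpF) (hli _ hpF)
  intro hp
  apply hy
  rw [hψs y, map_sum]
  refine Finset.sum_eq_zero fun i _ => ?_
  by_cases hi : i ∈ insert p F
  · rcases Finset.mem_insert.mp hi with rfl | hi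
    · simp [hp]
    · simp [hφ i hi]
  · simp [hψ0 y i hi]

/-- At most two maximal cones contain a given facet. -/
lemma not_three_cones {n m : ℕ} {v : Fin m → (Fin n → ℝ)} {𝓙 : Set (Finset (Fin m))}
    (hfan : IsSimplicialCompleteFan v 𝓙) {F : Finset (Fin m)} {a b c : Fin m}
    (ha : a ∉ F) (hb : b ∉ F) (hc : c ∉ F) (hab : a ≠ b) (hac : a ≠ c) (hbc : b ≠ c)
    (haF : insert a F ∈ 𝓙) (hbF : insert b F ∈ 𝓙) (hcF : insert c F ∈ 𝓙) : False := by
  classical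
  obtain ⟨ψ, -, -, hψw⟩ := exists_coordinates v _ (hfan.2.2.2.1 _ hcF)
    (hfan.2.2.2.2.2.1 _ hcF)
  have hval : ∀ i ∈ insert c F, ψ c (v i) = if c = i then 1 else 0 := fun i hi => by
    have := hψw (fun j => if j = i then 1 else 0) (fun j hj => by
      have : j ≠ i := fun h => hj (h ▸ hi)
      simp [this]) c
    simpa [ite_smul] using this
  have hφ : ∀ i ∈ F, ψ c (v i) = 0 := fun i hi => by
    rw [hval i (Finset.mem_insert_of_mem hi), if_neg]
    rintro rfl
    exact hc hi
  have hφc : ψ c (v c) = 1 := by simp [hval c (Finset.mem_insert_self _ _)]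
  have hne : ψ c (v c) ≠ 0 := by simp [hφc]
  have hneg : ∀ p, p ∉ F → p ≠ c → insert p F ∈ 𝓙 → ψ c (v p) < 0 := fun p hp hpc hpF => by
    rcases lt_trichotomy (ψ c (v p)) 0 with h | h | h
    · exact h
    · exact absurd h (map_ray_ne_zero hfan hpF hφ hne)
    · exact (not_same_side hfan hp hc hpc hpF hcF _ hφ h (by simp [hφc])).elim
  refine not_same_side hfan ha hb hab haF hbF (-ψ c) (fun i hi => by simp [hφ i hi]) ?_ ?_
  · simpa using hneg a ha hac haF
  · simpa using hneg b hb hbc hbF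

theorem stmt_3 {n : ℕ} (hn : 1 ≤ n) {m : ℕ} (hm : m = n + 2)
    (v : Fin m → (Fin n → ℝ)) (𝓙 : Set (Finset (Fin m)))
    (hfan : IsSimplicialCompleteFan v 𝓙)
    (𝓘 : Set (Finset (Fin m))) (h𝓘 : 𝓘 = {I | ∃ J ∈ 𝓙, I = Jᶜ})
    (a b c : Fin m) (hab : a ≠ b) (hac : a ≠ c) (hbc : b ≠ c)
    (hab𝓘 : ({a, b} : Finset (Fin m)) ∈ 𝓘) :
    Xor' (({a, c} : Finset (Fin m)) ∈ 𝓘) (({b, c} : Finset (Fin m)) ∈ 𝓘) := by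
  have hmem : ∀ I : Finset (Fin m), I ∈ 𝓘 ↔ Iᶜ ∈ 𝓙 := fun I => by
    subst h𝓘
    constructor
    · rintro ⟨J, hJ, rfl⟩
      rwa [compl_compl]
    · exact fun h => ⟨Iᶜ, h, (compl_compl I).symm⟩
  let F : Finset (Fin m) := {a, b, c}ᶜ
  have haF : a ∉ F := by simp [F]
  have hbF : b ∉ F := by simp [F]
  have hcF : c ∉ F := by simp [F]
  have h1 : ({a, b} : Finset (Fin m))ᶜ = insert c F := by
    ext i; simp only [F, Finset.mem_compl, Finset.mem_insert, Finset.mem_singleton]; grind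
  have h2 : ({a, c} : Finset (Fin m))ᶜ = insert b F := by
    ext i; simp only [F, Finset.mem_compl, Finset.mem_insert, Finset.mem_singleton]; grind
  have h3 : ({b, c} : Finset (Fin m))ᶜ = insert a F := by
    ext i; simp only [F, Finset.mem_compl, Finset.mem_insert, Finset.mem_singleton]; grind
  rw [hmem, h1] at hab𝓘
  rw [hmem, hmem, h2, h3]
  have hnot : ¬(insert b F ∈ 𝓙 ∧ insert a F ∈ 𝓙) := fun ⟨hb, ha⟩ =>
    not_three_cones hfan haF hbF hcF hab hac hbc ha hb hab𝓘
  suffices h : insert b F ∈ 𝓙 ∨ insert a F ∈ 𝓙 from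
    h.imp (fun hb => ⟨hb, fun ha => hnot ⟨hb, ha⟩⟩) fun ha => ⟨ha, fun hb => hnot ⟨hb, ha⟩⟩
  obtain ⟨J, hJ, hFJ, hcJ⟩ := exists_adjacent_cone hfan hcF hab𝓘
  have hcardJ : J.card = F.card + 1 := by
    rw [hfan.2.2.2.1 _ hJ, ← hfan.2.2.2.1 _ hab𝓘, Finset.card_insert_of_notMem hcF]
  obtain ⟨p, hpJ, hpF⟩ := Finset.exists_mem_notMem_of_card_lt_card (s := F) (t := J) (by omega)
  have hJp : insert p F = J := Finset.eq_of_subset_of_card_le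
    (Finset.insert_subset hpJ hFJ) (by rw [hcardJ, Finset.card_insert_of_notMem hpF])
  have hp : p = a ∨ p = b ∨ p = c := by
    simpa only [F, Finset.mem_compl, not_not, Finset.mem_insert, Finset.mem_singleton] using hpF
  rcases hp with rfl | rfl | rfl
  · exact Or.inr (hJp ▸ hJ)
  · exact Or.inl (hJp ▸ hJ)
  · exact absurd hpJ hcJ
end

section
/- Let r = 2 and let the data (v_1, …, v_m; 𝓙) be a simplicial complete fan in ℝ^n with m = n + 2 ray generators, and let Q be a Gale dual matrix of V with columns q_1, …, q_m ∈ ℝ². Let a, b, c ∈ {1,…,m} be pairwise distinct indices with {a, b} ∈ 𝓘, and suppose that q_a lies in the cone of nonnegative linear combinations of q_b and q_c. Then {b, c} ∈ 𝓘 and {a, c} ∉ 𝓘. -/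
open Finset Matrix

/-- The vanishing criterion for linear independence of `v` on `J`, in terms of coefficient
functions supported in `J`. -/
lemma eq_zero_of_sum_smul_eq_zero {m d : ℕ} {v : Fin m → (Fin d → ℝ)} {J : Finset (Fin m)}
    (hJ : LinearIndependent ℝ (fun j : J => v j)) {f : Fin m → ℝ} (hf : ∀ i ∉ J, f i = 0)
    (h : ∑ i, f i • v i = 0) : f = 0 := by
  have hJ' : LinearIndepOn ℝ v (J : Set (Fin m)) := hJ
  rw [linearIndepOn_finset_iff] at hJ'
  have hsum : ∑ i ∈ J, f i • v i = 0 := by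
    rw [← h]
    exact Finset.sum_subset (Finset.subset_univ J) fun i _ hi => by simp [hf i hi]
  funext i
  by_cases hi : i ∈ J
  · exact hJ' f hsum i hi
  · exact hf i hi

lemma eq_of_sum_smul_eq {m d : ℕ} {v : Fin m → (Fin d → ℝ)} {J : Finset (Fin m)}
    (hJ : LinearIndependent ℝ (fun j : J => v j)) {f g : Fin m → ℝ} (hf : ∀ i ∉ J, f i = 0)
    (hg : ∀ i ∉ J, g i = 0) (h : ∑ i, f i • v i = ∑ i, g i • v i) : f = g := by
  refine sub_eq_zero.mp (eq_zero_of_sum_smul_eq_zero hJ (f := f - g) ?_ ?_)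
  · intro i hi
    simp [hf i hi, hg i hi]
  · simp [sub_smul, h]

/-- `n` linearly independent vectors of `ℝ^n` span. -/
lemma exists_eq_sum_smul {n m : ℕ} {v : Fin m → (Fin n → ℝ)} {J : Finset (Fin m)}
    (hJ : LinearIndependent ℝ (fun j : J => v j)) (hcard : J.card = n) (x : Fin n → ℝ) :
    ∃ f : Fin m → ℝ, (∀ i ∉ J, f i = 0) ∧ x = ∑ i, f i • v i := by
  have hspan := hJ.span_eq_top_of_card_eq_finrank' (by simp [hcard])
  have hx : x ∈ Submodule.span ℝ (Set.range fun j : J => v j) := hspan ▸ Submodule.mem_top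
  obtain ⟨g, hg⟩ := (Submodule.mem_span_range_iff_exists_fun ℝ).mp hx
  refine ⟨fun i => if h : i ∈ J then g ⟨i, h⟩ else 0, fun i hi => by simp [hi], ?_⟩
  rw [← hg, ← Finset.sum_subset (Finset.subset_univ J) fun i _ hi => by simp [hi],
    ← Finset.sum_coe_sort J]
  exact Finset.sum_congr rfl fun i _ => by simp

/-- In a simplicial fan, a point has a unique representation as a nonnegative combination of the
generators of a maximal cone, even across different maximal cones. -/
lemma IsSimplicialCompleteFan.coeff_unique {n m : ℕ} {v : Fin m → (Fin n → ℝ)}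
    {𝓙 : Set (Finset (Fin m))} (hfan : IsSimplicialCompleteFan v 𝓙) {J J' : Finset (Fin m)}
    (hJ : J ∈ 𝓙) (hJ' : J' ∈ 𝓙) {f g : Fin m → ℝ} (hf0 : ∀ i, 0 ≤ f i) (hg0 : ∀ i, 0 ≤ g i)
    (hf : ∀ i ∉ J, f i = 0) (hg : ∀ i ∉ J', g i = 0)
    (h : ∑ i, f i • v i = ∑ i, g i • v i) : f = g := by
  obtain ⟨-, -, -, -, -, hind, hint, -⟩ := hfan
  have hmem : ∑ i, f i • v i ∈ coneOf v J ∩ coneOf v J' := ⟨⟨f, hf0, hf, rfl⟩, ⟨g, hg0, hg, h⟩⟩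
  rw [hint J hJ J' hJ'] at hmem
  obtain ⟨e, -, he, hfe⟩ := hmem
  have hfe' : f = e :=
    eq_of_sum_smul_eq (hind J hJ) hf (fun i hi => he i fun hi' => hi (mem_inter.mp hi').1) hfe
  have hge : g = e :=
    eq_of_sum_smul_eq (hind J' hJ') hg (fun i hi => he i fun hi' => hi (mem_inter.mp hi').2)
      (h ▸ hfe)
  rw [hfe', hge]

/-- Crossing a wall: a maximal cone `J` has, through each of its facets `J.erase c`, a
neighbouring maximal cone that does not contain the index `c`. -/
lemma IsSimplicialCompleteFan.exists_adjacent_s4 {n m : ℕ} {v : Fin m → (Fin n → ℝ)}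
    {𝓙 : Set (Finset (Fin m))} (hfan : IsSimplicialCompleteFan v 𝓙) {J : Finset (Fin m)}
    (hJ : J ∈ 𝓙) (c : Fin m) : ∃ J' ∈ 𝓙, J.erase c ⊆ J' ∧ c ∉ J' := by
  obtain ⟨-, -, -, hcard, -, hind, -, huniv⟩ := id hfan
  set e : Fin m → ℝ := fun i => if i ∈ J.erase c then 1 else 0 with he
  set p : Fin n → ℝ := ∑ i, e i • v i with hp
  have hcover : ∀ k : ℕ, ∃ J' ∈ 𝓙, p - (1 / ((k : ℝ) + 1)) • v c ∈ coneOf v J' := by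
    intro k
    have hk : p - (1 / ((k : ℝ) + 1)) • v c ∈ ⋃ J ∈ 𝓙, coneOf v J := huniv ▸ Set.mem_univ _
    simpa using hk
  choose F hF𝓙 hF using hcover
  obtain ⟨J', hinf⟩ := Finite.exists_infinite_fiber F
  have hinf' : (F ⁻¹' {J'}).Infinite := Set.infinite_coe_iff.mp hinf
  obtain ⟨k₀, hk₀⟩ := hinf'.nonempty
  have hJ' : J' ∈ 𝓙 := by
    have := hF𝓙 k₀
    rwa [show F k₀ = J' from hk₀] at this
  obtain ⟨α, hα, hpα⟩ := exists_eq_sum_smul (hind J' hJ') (hcard J' hJ') p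
  obtain ⟨β, hβ, hcβ⟩ := exists_eq_sum_smul (hind J' hJ') (hcard J' hJ') (v c)
  have hnonneg : ∀ k ∈ F ⁻¹' {J'}, ∀ i, 0 ≤ α i - 1 / ((k : ℝ) + 1) * β i := by
    intro k hk i
    have hmem := hF k
    rw [show F k = J' from hk] at hmem
    obtain ⟨γ, hγ0, hγ, hγsum⟩ := hmem
    have heq : (fun i => α i - 1 / ((k : ℝ) + 1) * β i) = γ := by
      refine eq_of_sum_smul_eq (hind J' hJ') (fun i hi => by simp [hα i hi, hβ i hi]) hγ ?_
      rw [← hγsum, hpα, hcβ, Finset.smul_sum, ← Finset.sum_sub_distrib]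
      exact Finset.sum_congr rfl fun i _ => by rw [sub_smul, mul_smul]
    have := hγ0 i
    rwa [← heq] at this
  have hα0 : ∀ i, 0 ≤ α i := by
    intro i
    by_contra! hneg
    obtain ⟨N, hN⟩ := exists_nat_gt (β i / α i)
    obtain ⟨k, hk, hNk⟩ := hinf'.exists_gt N
    have h1 := hnonneg k hk i
    have hNk' : (N : ℝ) < k := by exact_mod_cast hNk
    have hk1 : (0 : ℝ) < (k : ℝ) + 1 := by positivity
    have h2 : 0 ≤ α i * ((k : ℝ) + 1) - β i := by
      have := mul_nonneg h1 hk1.le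
      field_simp at this
      linarith
    have h3 : β i / α i < (k : ℝ) + 1 := by linarith
    rw [div_lt_iff_of_neg hneg] at h3
    linarith
  have heα : e = α :=
    hfan.coeff_unique hJ hJ' (fun i => by simp only [he]; split_ifs <;> norm_num) hα0
      (fun i hi => by simp [he, hi]) hα (hp ▸ hpα)
  have hsub : J.erase c ⊆ J' := by
    intro i hi
    by_contra hi'
    have h0 := hα i hi'
    rw [← heα] at h0
    simp only [he, if_pos hi] at h0
    exact one_ne_zero h0
  refine ⟨J', hJ', hsub, fun hcJ' => ?_⟩
  have hβc : β = Pi.single c 1 := by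
    refine eq_of_sum_smul_eq (hind J' hJ') hβ (fun i hi => ?_) ?_
    · exact Pi.single_eq_of_ne (fun h : i = c => hi (h ▸ hcJ')) _
    · rw [← hcβ]
      simp [Pi.single_apply, ite_smul]
  have h1 := hnonneg k₀ hk₀ c
  rw [← heα, hβc] at h1
  have h2 : (0 : ℝ) < 1 / ((k₀ : ℝ) + 1) := by positivity
  simp only [he, Finset.mem_erase, ne_eq, not_true_eq_false, false_and, if_false,
    Pi.single_eq_same] at h1
  linarith

/-- A linear functional on the Gale dual vectors gives a linear relation among the columns. -/
lemma sum_vecMul_smul_eq_zero {n m r : ℕ} {V : Matrix (Fin n) (Fin m) ℝ}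
    {Q : Matrix (Fin r) (Fin m) ℝ} (hQV : Q * Vᵀ = 0) (w : Fin r → ℝ) :
    ∑ i, (w ᵥ* Q) i • (fun x => V x i) = 0 := by
  have h : (w ᵥ* Q) ᵥ* Vᵀ = 0 := by rw [Matrix.vecMul_vecMul, hQV, Matrix.vecMul_zero]
  funext x
  have hx := congrFun h x
  simpa [Matrix.vecMul, dotProduct] using hx

/-- Gale duality: if the columns of `V` off `{a, b}` are independent then `q_a, q_b` are. -/
lemma gale_det_ne_zero {n m : ℕ} {V : Matrix (Fin n) (Fin m) ℝ} {Q : Matrix (Fin 2) (Fin m) ℝ}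
    (hQrank : Q.rank = 2) (hQV : Q * Vᵀ = 0) {a b : Fin m}
    (hind : LinearIndependent ℝ (fun j : (({a, b} : Finset (Fin m))ᶜ : Finset (Fin m)) =>
      (fun x => V x j))) : Q 0 a * Q 1 b - Q 0 b * Q 1 a ≠ 0 := by
  intro hdet
  obtain ⟨w, hw, hwM⟩ := (Matrix.exists_vecMul_eq_zero_iff
    (M := !![Q 0 a, Q 0 b; Q 1 a, Q 1 b])).mpr (by rw [Matrix.det_fin_two_of]; exact hdet)
  have ha := congrFun hwM 0
  have hb := congrFun hwM 1
  simp [Matrix.vecMul, dotProduct, Fin.sum_univ_two] at ha hb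
  have hwQ : w ᵥ* Q = 0 := by
    refine eq_zero_of_sum_smul_eq_zero (v := fun i x => V x i) hind (fun i hi => ?_)
      (sum_vecMul_smul_eq_zero hQV w)
    simp only [Finset.mem_compl, Finset.mem_insert, Finset.mem_singleton, not_not] at hi
    rcases hi with rfl | rfl <;> simp [Matrix.vecMul, dotProduct, Fin.sum_univ_two, ha, hb]
  have hrows : LinearIndependent ℝ Q.row := by
    rw [linearIndependent_iff_card_eq_finrank_span, Set.finrank, ← Matrix.rank_eq_finrank_span_row, hQrank]
    simp
  exact hw (Matrix.vecMul_injective_iff.mpr hrows (by simp [hwQ]))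

theorem stmt_4 {n : ℕ} (hn : 1 ≤ n) {m : ℕ} (hm : m = n + 2)
    (V : Matrix (Fin n) (Fin m) ℝ) (Q : Matrix (Fin 2) (Fin m) ℝ)
    (𝓙 : Set (Finset (Fin m)))
    (hfan : IsSimplicialCompleteFan (fun i a => V a i) 𝓙)
    (hQrank : Q.rank = 2) (hQV : Q * Vᵀ = 0)
    (𝓘 : Set (Finset (Fin m))) (h𝓘 : 𝓘 = {I | ∃ J ∈ 𝓙, I = Jᶜ})
    (a b c : Fin m) (hab : a ≠ b) (hac : a ≠ c) (hbc : b ≠ c)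
    (hab𝓘 : ({a, b} : Finset (Fin m)) ∈ 𝓘)
    (hcone : ∃ s t : ℝ, 0 ≤ s ∧ 0 ≤ t ∧
      (fun x => Q x a) = s • (fun x => Q x b) + t • (fun x => Q x c)) :
    ({b, c} : Finset (Fin m)) ∈ 𝓘 ∧ ({a, c} : Finset (Fin m)) ∉ 𝓘 := by
  have hmem : ∀ I : Finset (Fin m), I ∈ 𝓘 ↔ Iᶜ ∈ 𝓙 := by
    intro I
    rw [h𝓘]
    constructor
    · rintro ⟨J, hJ, rfl⟩
      rwa [compl_compl]
    · exact fun h => ⟨Iᶜ, h, (compl_compl I).symm⟩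
  obtain ⟨-, -, -, hcard, -, hind, -, -⟩ := id hfan
  rw [hmem] at hab𝓘
  have hacnot : ({a, c} : Finset (Fin m)) ∉ 𝓘 := by
    rw [hmem]
    intro hac𝓙
    obtain ⟨s, t, hs, ht, hq⟩ := hcone
    have hq0 : Q 0 a = s * Q 0 b + t * Q 0 c := by simpa using congrFun hq 0
    have hq1 : Q 1 a = s * Q 1 b + t * Q 1 c := by simpa using congrFun hq 1
    set D := Q 0 a * Q 1 b - Q 0 b * Q 1 a with hD
    have hD0 : D ≠ 0 := gale_det_ne_zero hQrank hQV (hind _ hab𝓘)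
    -- the relation given by the functional vanishing at `q_a` and equal to one at `q_b`
    set μ : Fin m → ℝ := ![-Q 1 a / D, Q 0 a / D] ᵥ* Q with hμ
    have hμi : ∀ i, μ i = (Q 0 a * Q 1 i - Q 0 i * Q 1 a) / D := by
      intro i
      simp [hμ, Matrix.vecMul, dotProduct, Fin.sum_univ_two]
      ring
    have hμa : μ a = 0 := by rw [hμi]; ring
    have hμb : μ b = 1 := by rw [hμi, ← hD, div_self hD0]
    have hrel : s * μ b + t * μ c = 0 := by
      rw [← hμa, hμi, hμi, hμi, hq0, hq1]
      ring
    rw [hμb, mul_one] at hrel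
    have ht0 : 0 < t := by
      refine lt_of_le_of_ne ht fun h => hD0 ?_
      have hs0 : s = 0 := by rw [← h] at hrel; linarith
      rw [hD, hq0, hq1, hs0, ← h]
      ring
    have hμc : μ c ≤ 0 := by
      by_contra! hpos
      have := mul_pos ht0 hpos
      linarith
    have hsum := sum_vecMul_smul_eq_zero hQV ![-Q 1 a / D, Q 0 a / D]
    rw [← hμ] at hsum
    have heq : (fun i => max (μ i) 0) = fun i => max (-μ i) 0 := by
      refine hfan.coeff_unique hac𝓙 hab𝓘 (fun i => le_max_right _ _) (fun i => le_max_right _ _)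
        (fun i hi => ?_) (fun i hi => ?_) ?_
      · simp only [Finset.mem_compl, Finset.mem_insert, Finset.mem_singleton, not_not] at hi
        rcases hi with rfl | rfl
        · simp [hμa]
        · exact max_eq_right hμc
      · simp only [Finset.mem_compl, Finset.mem_insert, Finset.mem_singleton, not_not] at hi
        rcases hi with rfl | rfl
        · simp [hμa]
        · simp [hμb]
      · rw [← sub_eq_zero, ← Finset.sum_sub_distrib, ← hsum]
        refine Finset.sum_congr rfl fun i _ => ?_
        rw [← sub_smul]
        congr 1
        rcases le_total (μ i) 0 with h | h
        · rw [max_eq_right h, max_eq_left (by linarith)]; ring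
        · rw [max_eq_left h, max_eq_right (by linarith)]; ring
    have hb := congrFun heq b
    norm_num [hμb] at hb
  refine ⟨?_, hacnot⟩
  obtain ⟨J', hJ', hsub, hcJ'⟩ := hfan.exists_adjacent_s4 hab𝓘 c
  have hJ'card : J'ᶜ.card = 2 := by
    rw [Finset.card_compl, hcard J' hJ', Fintype.card_fin]
    omega
  have hout : ∀ i ∈ J'ᶜ, i = a ∨ i = b ∨ i = c := by
    intro i hi
    by_contra! h
    exact Finset.mem_compl.mp hi (hsub (by simp [h]))
  have hbJ' : b ∉ J' := by
    intro hb
    have hcompl : J'ᶜ = {a, c} := by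
      refine Finset.eq_of_subset_of_card_le (fun i hi => ?_) (by rw [hJ'card]; exact card_le_two)
      rcases hout i hi with rfl | rfl | rfl
      · simp
      · exact absurd hb (Finset.mem_compl.mp hi)
      · simp
    exact hacnot ((hmem _).mpr (by rwa [← hcompl, compl_compl]))
  have hcompl : ({b, c} : Finset (Fin m)) = J'ᶜ := by
    refine Finset.eq_of_subset_of_card_le ?_ (by rw [hJ'card, Finset.card_pair hbc])
    simp [Finset.insert_subset_iff, hbJ', hcJ']
  rw [hmem, hcompl, compl_compl]
  exact hJ'
end

section
/- (Combinatorial form of the main theorem: every ℚ-factorial complete toric variety of Picard number 2 is projective.) Let r = 2 and let the data (v_1, …, v_m; 𝓙) be a simplicial complete fan in ℝ^n with m = n + 2 ray generators, and let Q be a Gale dual matrix of V with columns q_1, …, q_m ∈ ℝ². Then the intersection ⋂_{I ∈ 𝓘} ⟨Q_I⟩ ⊆ ℝ² has nonempty topological interior, i.e., it is a full-dimensional (2-dimensional) cone. (By the standard criterion, this intersection is the nef cone of the associated toric variety, and its full-dimensionality is equivalent to projectivity.) -/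
open Finset Matrix

/-- Two matrices forming a complex `ℝ^r → ℝ^m → ℝ^n`, with `V` onto and `Q` of rank `r = m - n`,
form an exact sequence. -/
theorem exists_transpose_mulVec_eq {n m r : ℕ} (hm : m = n + r)
    {V : Matrix (Fin n) (Fin m) ℝ} {Q : Matrix (Fin r) (Fin m) ℝ}
    (hV : Function.Surjective V.mulVec) (hQrank : Q.rank = r) (hQV : Q * Vᵀ = 0)
    {u : Fin m → ℝ} (hu : V *ᵥ u = 0) : ∃ w, Qᵀ *ᵥ w = u := by
  have hVQ : V * Qᵀ = 0 := by simpa using congrArg Matrix.transpose hQV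
  have hle : LinearMap.range Qᵀ.mulVecLin ≤ LinearMap.ker V.mulVecLin := by
    rintro _ ⟨w, rfl⟩
    rw [LinearMap.mem_ker, mulVecLin_apply, mulVecLin_apply, mulVec_mulVec, hVQ, zero_mulVec]
  have hrange : Module.finrank ℝ (LinearMap.range Qᵀ.mulVecLin) = r :=
    (Matrix.rank_transpose Q).trans hQrank
  have hker : Module.finrank ℝ (LinearMap.ker V.mulVecLin) = r := by
    have h := LinearMap.finrank_range_add_finrank_ker V.mulVecLin
    rw [LinearMap.range_eq_top.2 hV, finrank_top] at h
    simp only [Module.finrank_fin_fun] at h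
    omega
  have heq := Submodule.eq_of_le_of_finrank_eq hle (hrange.trans hker.symm)
  have hmem : u ∈ LinearMap.range Qᵀ.mulVecLin := by
    rw [heq]
    exact hu
  exact hmem

theorem transpose_mulVec_injective {m r : ℕ} {Q : Matrix (Fin r) (Fin m) ℝ}
    (hQrank : Q.rank = r) : Function.Injective Qᵀ.mulVec := by
  have h := LinearMap.finrank_range_add_finrank_ker Qᵀ.mulVecLin
  have hrange : Module.finrank ℝ (LinearMap.range Qᵀ.mulVecLin) = r :=
    (Matrix.rank_transpose Q).trans hQrank
  rw [hrange, Module.finrank_fin_fun] at h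
  have hker : Module.finrank ℝ (LinearMap.ker Qᵀ.mulVecLin) = 0 := by omega
  exact LinearMap.ker_eq_bot.1 (Submodule.finrank_eq_zero.1 hker)

namespace IsSimplicialCompleteFan

variable {n m : ℕ} {v : Fin m → (Fin n → ℝ)} {𝓙 : Set (Finset (Fin m))}

theorem exists_nonneg_sum_eq (h : IsSimplicialCompleteFan v 𝓙) (x : Fin n → ℝ) :
    ∃ c : Fin m → ℝ, (∀ i, 0 ≤ c i) ∧ ∑ i, c i • v i = x := by
  have hx : x ∈ ⋃ J ∈ 𝓙, coneOf v J := h.2.2.2.2.2.2.2 ▸ Set.mem_univ x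
  obtain ⟨J, -, c, hc, -, rfl⟩ := Set.mem_iUnion₂.1 hx
  exact ⟨c, hc, rfl⟩

theorem exists_pos_sum_eq_zero (h : IsSimplicialCompleteFan v 𝓙) :
    ∃ u : Fin m → ℝ, (∀ i, 0 < u i) ∧ ∑ i, u i • v i = 0 := by
  obtain ⟨c, hc, hsum⟩ := h.exists_nonneg_sum_eq (-∑ i, v i)
  refine ⟨fun i => 1 + c i, fun i => by linarith [hc i], ?_⟩
  simp [add_smul, sum_add_distrib, hsum]

theorem eq_of_sum_eq (h : IsSimplicialCompleteFan v 𝓙) {J : Finset (Fin m)} (hJ : J ∈ 𝓙)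
    {c d : Fin m → ℝ} (hc : ∀ i ∉ J, c i = 0) (hd : ∀ i ∉ J, d i = 0)
    (hcd : ∑ i, c i • v i = ∑ i, d i • v i) : c = d := by
  have hli : LinearIndepOn ℝ v (J : Set (Fin m)) := h.2.2.2.2.2.1 J hJ
  have hsum : ∑ i ∈ J, (c i - d i) • v i = 0 := by
    rw [Finset.sum_subset (Finset.subset_univ J)
      (fun i _ hi => by rw [hc i hi, hd i hi, sub_zero, zero_smul])]
    simp [sub_smul, hcd]
  ext i
  by_cases hi : i ∈ J
  · exact sub_eq_zero.1 (linearIndepOn_finset_iff.1 hli _ hsum i hi)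
  · rw [hc i hi, hd i hi]

/-- A linear relation cannot be nonnegative outside one maximal cone and nonpositive outside
another: its positive and negative parts would give a common point of the two cones. -/
theorem eq_zero_of_sum_eq_zero (h : IsSimplicialCompleteFan v 𝓙) {J J' : Finset (Fin m)}
    (hJ : J ∈ 𝓙) (hJ' : J' ∈ 𝓙) {y : Fin m → ℝ} (hy : ∑ i, y i • v i = 0)
    (hnonneg : ∀ i ∉ J, 0 ≤ y i) (hnonpos : ∀ i ∉ J', y i ≤ 0) : y = 0 := by
  have hneg : ∀ i ∉ J, (y i)⁻ = 0 := fun i hi => negPart_eq_zero.2 (hnonneg i hi)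
  have hpos : ∀ i ∉ J', (y i)⁺ = 0 := fun i hi => posPart_eq_zero.2 (hnonpos i hi)
  have hparts : ∑ i, (y i)⁺ • v i = ∑ i, (y i)⁻ • v i := by
    rw [← sub_eq_zero, ← hy, ← sum_sub_distrib]
    exact sum_congr rfl fun i _ => by rw [← sub_smul, posPart_sub_negPart]
  have hmem : ∑ i, (y i)⁺ • v i ∈ coneOf v (J ∩ J') := by
    rw [← h.2.2.2.2.2.2.1 J hJ J' hJ']
    exact ⟨⟨fun i => (y i)⁻, fun i => negPart_nonneg _, hneg, hparts⟩,
      ⟨fun i => (y i)⁺, fun i => posPart_nonneg _, hpos, rfl⟩⟩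
  obtain ⟨c, -, hc, hsum⟩ := hmem
  have hcJ : ∀ i ∉ J, c i = 0 := fun i hi => hc i fun hi' => hi (mem_inter.1 hi').1
  have hcJ' : ∀ i ∉ J', c i = 0 := fun i hi => hc i fun hi' => hi (mem_inter.1 hi').2
  have hposc := h.eq_of_sum_eq hJ' hpos hcJ' hsum
  have hnegc := h.eq_of_sum_eq hJ hneg hcJ (hparts.symm.trans hsum)
  ext i
  rw [← posPart_sub_negPart (y i), congrFun hposc i, congrFun hnegc i, sub_self, Pi.zero_apply]

end IsSimplicialCompleteFan

/-- In the plane, with coordinates `x ↦ (w ⬝ᵥ x, w' ⬝ᵥ x)`, a vector whose slope lies between those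
of two vectors of the right half-plane lies in the cone they span. -/
theorem mem_coneOf_of_slope {m : ℕ} {q : Fin m → (Fin 2 → ℝ)} {S : Finset (Fin m)} {a b : Fin m}
    (ha : a ∈ S) (hb : b ∈ S) {w w' x : Fin 2 → ℝ}
    (hw : ∀ z, w ⬝ᵥ z = 0 → w' ⬝ᵥ z = 0 → z = 0) (hqa : 0 < w ⬝ᵥ q a) (hqb : 0 < w ⬝ᵥ q b)
    (hab : w' ⬝ᵥ q a / w ⬝ᵥ q a < w' ⬝ᵥ q b / w ⬝ᵥ q b)
    (hxa : w' ⬝ᵥ q a / w ⬝ᵥ q a * w ⬝ᵥ x ≤ w' ⬝ᵥ x)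
    (hxb : w' ⬝ᵥ x ≤ w' ⬝ᵥ q b / w ⬝ᵥ q b * w ⬝ᵥ x) : x ∈ coneOf q S := by
  set s := w' ⬝ᵥ q a / w ⬝ᵥ q a with hs
  set t := w' ⬝ᵥ q b / w ⬝ᵥ q b with ht
  have hsa : w' ⬝ᵥ q a = s * w ⬝ᵥ q a := by rw [hs]; field_simp
  have htb : w' ⬝ᵥ q b = t * w ⬝ᵥ q b := by rw [ht]; field_simp
  have hst : 0 < t - s := sub_pos.2 hab
  set l := (t * w ⬝ᵥ x - w' ⬝ᵥ x) / ((t - s) * w ⬝ᵥ q a) with hl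
  set k := (w' ⬝ᵥ x - s * w ⬝ᵥ x) / ((t - s) * w ⬝ᵥ q b) with hk
  have hl0 : 0 ≤ l := div_nonneg (sub_nonneg.2 hxb) (by positivity)
  have hk0 : 0 ≤ k := div_nonneg (sub_nonneg.2 hxa) (by positivity)
  have hla : l * w ⬝ᵥ q a = (t * w ⬝ᵥ x - w' ⬝ᵥ x) / (t - s) := by rw [hl]; field_simp
  have hkb : k * w ⬝ᵥ q b = (w' ⬝ᵥ x - s * w ⬝ᵥ x) / (t - s) := by rw [hk]; field_simp
  have hx : x = l • q a + k • q b := by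
    refine sub_eq_zero.1 (hw _ ?_ ?_)
    · simp only [dotProduct_sub, dotProduct_add, dotProduct_smul, smul_eq_mul]
      rw [hla, hkb]
      field_simp
      ring
    · simp only [dotProduct_sub, dotProduct_add, dotProduct_smul, smul_eq_mul]
      rw [hsa, htb, mul_left_comm l, mul_left_comm k, hla, hkb]
      field_simp
      ring
  refine ⟨Pi.single a l + Pi.single b k, fun i => ?_, fun i hi => ?_, ?_⟩
  · simp only [Pi.add_apply, Pi.single_apply]
    split_ifs <;> positivity
  · have hia : i ≠ a := fun h => hi (h ▸ ha)
    have hib : i ≠ b := fun h => hi (h ▸ hb)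
    simp [hia, hib]
  · simpa [add_smul, sum_add_distrib, Pi.single_apply] using hx

/-- Combinatorial form of the main theorem: for a simplicial complete fan with Picard
number `r = 2`, the intersection of the Gale-dual bunch of cones (the nef cone) is a
full-dimensional cone in ℝ², i.e. has nonempty topological interior; equivalently the
associated ℚ-factorial complete toric variety is projective. -/
theorem stmt_5 {n : ℕ} (hn : 1 ≤ n) {m : ℕ} (hm : m = n + 2)
    (V : Matrix (Fin n) (Fin m) ℝ) (Q : Matrix (Fin 2) (Fin m) ℝ)
    (𝓙 : Set (Finset (Fin m)))
    (hfan : IsSimplicialCompleteFan (fun i a => V a i) 𝓙)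
    (hQrank : Q.rank = 2) (hQV : Q * Vᵀ = 0)
    (𝓘 : Set (Finset (Fin m))) (h𝓘 : 𝓘 = {I | ∃ J ∈ 𝓙, I = Jᶜ}) :
    (interior (⋂ I ∈ 𝓘, coneOf (fun i a => Q a i) I)).Nonempty := by
  subst h𝓘
  have hcol : ∀ c : Fin m → ℝ, V *ᵥ c = ∑ i, c i • fun a => V a i := fun c => by
    ext a
    simp [Matrix.mulVec, dotProduct, mul_comm]
  have hVQ : V * Qᵀ = 0 := by simpa using congrArg Matrix.transpose hQV
  have hsurj : Function.Surjective V.mulVec := fun x => by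
    obtain ⟨c, -, hc⟩ := hfan.exists_nonneg_sum_eq x
    exact ⟨c, (hcol c).trans hc⟩
  obtain ⟨u, hu, hsum⟩ := hfan.exists_pos_sum_eq_zero
  obtain ⟨w, rfl⟩ := exists_transpose_mulVec_eq hm hsurj hQrank hQV ((hcol u).trans hsum)
  have hdot : ∀ z i, (Qᵀ *ᵥ z) i = z ⬝ᵥ fun a => Q a i := fun z i => dotProduct_comm _ _
  simp only [hdot] at hu
  have hw : 0 < w 0 * w 0 + w 1 * w 1 := by
    by_contra hneg
    have h0 : w 0 = 0 := by nlinarith [mul_self_nonneg (w 0), mul_self_nonneg (w 1)]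
    have h1 : w 1 = 0 := by nlinarith [mul_self_nonneg (w 0), mul_self_nonneg (w 1)]
    have := hu ⟨0, by omega⟩
    simp [dotProduct, h0, h1] at this
  set w' : Fin 2 → ℝ := ![-w 1, w 0] with hw'
  have hbasis : ∀ z, w ⬝ᵥ z = 0 → w' ⬝ᵥ z = 0 → z = 0 := fun z h h' => by
    simp only [hw', dotProduct, Fin.sum_univ_two, cons_val_zero, cons_val_one] at h h'
    have h0 : (w 0 * w 0 + w 1 * w 1) * z 0 = 0 := by linear_combination w 0 * h - w 1 * h'
    have h1 : (w 0 * w 0 + w 1 * w 1) * z 1 = 0 := by linear_combination w 1 * h + w 0 * h'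
    ext i
    fin_cases i
    · exact (mul_eq_zero.1 h0).resolve_left hw.ne'
    · exact (mul_eq_zero.1 h1).resolve_left hw.ne'
  set t : Fin m → ℝ := fun i => (w' ⬝ᵥ fun a => Q a i) / (w ⬝ᵥ fun a => Q a i) with ht
  have hcross : ∀ J ∈ 𝓙, ∀ J' ∈ 𝓙, ∀ s, ¬((∀ i ∉ J, s ≤ t i) ∧ ∀ i ∉ J', t i ≤ s) := by
    rintro J hJ J' hJ' s ⟨hs, hs'⟩
    have hy : ∀ i, (Qᵀ *ᵥ (w' - s • w)) i = (w ⬝ᵥ fun a => Q a i) * (t i - s) := fun i => by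
      have := (hu i).ne'
      rw [hdot, sub_dotProduct, smul_dotProduct, smul_eq_mul, ht]
      field_simp
    have hzero : Qᵀ *ᵥ (w' - s • w) = 0 := by
      refine hfan.eq_zero_of_sum_eq_zero hJ hJ' ?_ (fun i hi => ?_) fun i hi => ?_
      · rw [← hcol, mulVec_mulVec, hVQ, zero_mulVec]
      · rw [hy]
        exact mul_nonneg (hu i).le (sub_nonneg.2 (hs i hi))
      · rw [hy]
        exact mul_nonpos_of_nonneg_of_nonpos (hu i).le (sub_nonpos.2 (hs' i hi))
    have hws := transpose_mulVec_injective hQrank (hzero.trans (mulVec_zero _).symm)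
    have h0 : -w 1 - s * w 0 = 0 := by simpa [hw'] using congrFun hws 0
    have h1 : w 0 - s * w 1 = 0 := by simpa [hw'] using congrFun hws 1
    exact hw.ne' (by linear_combination w 0 * h1 - w 1 * h0)
  have hne : ∀ J ∈ 𝓙, Jᶜ.Nonempty := fun J hJ => by
    rw [← card_pos, card_compl, hfan.2.2.2.1 J hJ, Fintype.card_fin]
    omega
  have hmin : ∀ J ∈ 𝓙, ∃ a ∈ Jᶜ, ∀ i ∈ Jᶜ, t a ≤ t i := fun J hJ =>
    exists_min_image _ _ (hne J hJ)
  have hmax : ∀ J ∈ 𝓙, ∃ b ∈ Jᶜ, ∀ i ∈ Jᶜ, t i ≤ t b := fun J hJ =>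
    exists_max_image _ _ (hne J hJ)
  have : Nonempty (Fin m) := ⟨⟨0, by omega⟩⟩
  choose! a haJ ha using hmin
  choose! b hbJ hb using hmax
  have hab : ∀ J ∈ 𝓙, ∀ J' ∈ 𝓙, t (a J) < t (b J') := fun J hJ J' hJ' => by
    by_contra! hle
    exact hcross J hJ J' hJ' (t (a J)) ⟨fun i hi => ha J hJ i (mem_compl.2 hi),
      fun i hi => (hb J' hJ' i (mem_compl.2 hi)).trans hle⟩
  obtain ⟨A, hA, hAmax⟩ := Set.exists_max_image 𝓙 (fun J => t (a J)) 𝓙.toFinite hfan.2.2.1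
  obtain ⟨B, hB, hBmin⟩ := Set.exists_min_image 𝓙 (fun J => t (b J)) 𝓙.toFinite hfan.2.2.1
  have hAB := hab A hA B hB
  obtain ⟨s, hs, hs'⟩ := exists_between hAB
  have hcont : ∀ z : Fin 2 → ℝ, Continuous fun x : Fin 2 → ℝ => z ⬝ᵥ x := fun z => by
    unfold dotProduct
    fun_prop
  refine ⟨w + s • w', mem_interior.2 ⟨{x | t (a A) * w ⬝ᵥ x < w' ⬝ᵥ x} ∩
    {x | w' ⬝ᵥ x < t (b B) * w ⬝ᵥ x}, ?_, ?_, ?_⟩⟩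
  · rintro x ⟨hxa, hxb⟩
    simp only [Set.mem_ofPred_eq] at hxa hxb
    have hx : 0 < w ⬝ᵥ x := by
      by_contra! hneg
      nlinarith
    simp only [Set.mem_iInter]
    rintro _ ⟨J, hJ, rfl⟩
    refine mem_coneOf_of_slope (haJ J hJ) (hbJ J hJ) hbasis (hu _) (hu _) (hab J hJ J hJ) ?_ ?_
    · exact (mul_le_mul_of_nonneg_right (hAmax J hJ) hx.le).trans hxa.le
    · exact hxb.le.trans (mul_le_mul_of_nonneg_right (hBmin J hJ) hx.le)
  · exact (isOpen_lt (continuous_const.mul (hcont w)) (hcont w')).inter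
      (isOpen_lt (hcont w') (continuous_const.mul (hcont w)))
  · have h : w ⬝ᵥ (w + s • w') = w 0 * w 0 + w 1 * w 1 := by
      simp [hw', dotProduct, Fin.sum_univ_two]
      ring
    have h' : w' ⬝ᵥ (w + s • w') = s * (w 0 * w 0 + w 1 * w 1) := by
      simp [hw', dotProduct, Fin.sum_univ_two]
      ring
    simp only [Set.mem_inter_iff, Set.mem_ofPred_eq, h, h']
    exact ⟨mul_lt_mul_of_pos_right hs hw, mul_lt_mul_of_pos_right hs' hw⟩
end

section
/- Let r = 2 and let the data (v_1, …, v_m; 𝓙) be a simplicial complete fan in ℝ^n with m = n + 2 ray generators, and let Q be a Gale dual matrix of V with columns q_1, …, q_m ∈ ℝ². Suppose I₀ ∈ 𝓘 is minimal, i.e. no column q_i (1 ≤ i ≤ m) lies in the relative interior of ⟨Q_{I₀}⟩. Then ⟨Q_{I₀}⟩ ⊆ ⟨Q_I⟩ for every I ∈ 𝓘. -/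
open Finset Matrix

theorem mem_coneOf_pair {m d : ℕ} {v : Fin m → (Fin d → ℝ)} {i j : Fin m} (hij : i ≠ j)
    {x : Fin d → ℝ} :
    x ∈ coneOf v {i, j} ↔ ∃ s t : ℝ, 0 ≤ s ∧ 0 ≤ t ∧ x = s • v i + t • v j := by
  constructor
  · rintro ⟨c, hc, hc0, rfl⟩
    refine ⟨c i, c j, hc i, hc j, ?_⟩
    rw [← Finset.sum_pair hij (f := fun k => c k • v k)]
    refine (Finset.sum_subset (Finset.subset_univ _) fun k _ hk => ?_).symm
    simp [hc0 k hk]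
  · rintro ⟨s, t, hs, ht, rfl⟩
    refine ⟨fun k => if k = i then s else if k = j then t else 0, fun k => ?_, fun k hk => ?_, ?_⟩
    · dsimp only
      split_ifs <;> first | assumption | exact le_rfl
    · simp only [Finset.mem_insert, Finset.mem_singleton, not_or] at hk
      simp [hk.1, hk.2]
    · rw [← Finset.sum_subset (Finset.subset_univ {i, j}), Finset.sum_pair hij]
      · simp [hij.symm]
      · intro k _ hk
        simp only [Finset.mem_insert, Finset.mem_singleton, not_or] at hk
        simp [hk.1, hk.2]

theorem coeff_eq_of_sum_smul_eq {m d : ℕ} {v : Fin m → (Fin d → ℝ)} {J : Finset (Fin m)}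
    (hJ : LinearIndependent ℝ (fun j : J => v j)) {c c' : Fin m → ℝ}
    (hc : ∀ i ∉ J, c i = 0) (hc' : ∀ i ∉ J, c' i = 0)
    (h : ∑ i, c i • v i = ∑ i, c' i • v i) : c = c' := by
  have restrict : ∀ b : Fin m → ℝ, (∀ i ∉ J, b i = 0) →
      ∑ j : J, b j • v j = ∑ i, b i • v i := fun b hb => by
    rw [Finset.sum_coe_sort J (fun i => b i • v i)]
    exact Finset.sum_subset (Finset.subset_univ _) fun k _ hk => by simp [hb k hk]
  have key : ∑ j : J, (c j - c' j) • v j = 0 := by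
    simp only [sub_smul, Finset.sum_sub_distrib]
    rw [restrict c hc, restrict c' hc', h, sub_self]
  funext i
  by_cases hi : i ∈ J
  · exact sub_eq_zero.1 (Fintype.linearIndependent_iff.1 hJ (fun j => c j - c' j) key ⟨i, hi⟩)
  · rw [hc i hi, hc' i hi]

/-- A linear relation that is nonnegative off one maximal cone and nonpositive off another one
meeting it in the common face is trivial. -/
theorem relation_eq_zero {m d : ℕ} {v : Fin m → (Fin d → ℝ)} {J J' : Finset (Fin m)}
    (hJ : LinearIndependent ℝ (fun j : J => v j))
    (hJ' : LinearIndependent ℝ (fun j : J' => v j))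
    (hJJ' : coneOf v J ∩ coneOf v J' = coneOf v (J ∩ J')) {c : Fin m → ℝ}
    (hc : ∑ i, c i • v i = 0) (hpos : ∀ i ∉ J, 0 ≤ c i) (hneg : ∀ i ∉ J', c i ≤ 0) :
    c = 0 := by
  have hsum : ∑ i, max (c i) 0 • v i = ∑ i, max (-c i) 0 • v i := by
    rw [← sub_eq_zero, ← Finset.sum_sub_distrib, ← hc]
    refine Finset.sum_congr rfl fun i _ => ?_
    rw [← sub_smul]
    congr 1
    rcases le_total (c i) 0 with h | h
    · rw [max_eq_right h, max_eq_left (by linarith)]; ring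
    · rw [max_eq_left h, max_eq_right (by linarith)]; ring
  have hp : ∀ i ∉ J', max (c i) 0 = 0 := fun i hi => max_eq_right (hneg i hi)
  have hn : ∀ i ∉ J, max (-c i) 0 = 0 := fun i hi => max_eq_right (by linarith [hpos i hi])
  have hmem : ∑ i, max (c i) 0 • v i ∈ coneOf v J ∩ coneOf v J' :=
    ⟨⟨fun i => max (-c i) 0, fun i => le_max_right _ _, hn, hsum⟩,
      ⟨fun i => max (c i) 0, fun i => le_max_right _ _, hp, rfl⟩⟩
  rw [hJJ'] at hmem
  obtain ⟨b, -, hb0, hb⟩ := hmem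
  have h1 := coeff_eq_of_sum_smul_eq hJ' hp
    (fun i hi => hb0 i fun h => hi (Finset.mem_inter.1 h).2) hb
  have h2 := coeff_eq_of_sum_smul_eq hJ hn
    (fun i hi => hb0 i fun h => hi (Finset.mem_inter.1 h).1) (hsum.symm.trans hb)
  funext i
  have h : max (c i) 0 = max (-c i) 0 := congrFun (h1.trans h2.symm) i
  rcases le_total (c i) 0 with hi | hi
  · rw [max_eq_right hi, max_eq_left (by linarith)] at h
    simpa using h.symm
  · rwa [max_eq_left hi, max_eq_right (by linarith)] at h

theorem eq_zero_of_vecMul_eq_zero {k m : ℕ} {Q : Matrix (Fin k) (Fin m) ℝ} (hQ : Q.rank = k)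
    {l : Fin k → ℝ} (hl : l ᵥ* Q = 0) : l = 0 := by
  have hli : LinearIndependent ℝ Q.row := by
    rw [linearIndependent_iff_card_eq_finrank_span, Set.finrank, ← Matrix.rank_eq_finrank_span_row,
      hQ, Fintype.card_fin]
  exact Matrix.vecMul_injective_iff.2 hli (by simpa using hl)

/-- Gale duality: the cones dual to two maximal cones of a fan are not weakly separated by a
nonzero linear functional. -/
theorem gale_functional_eq_zero {n m k : ℕ} {V : Matrix (Fin n) (Fin m) ℝ}
    {Q : Matrix (Fin k) (Fin m) ℝ} {𝓙 : Set (Finset (Fin m))}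
    (hfan : IsSimplicialCompleteFan (fun i a => V a i) 𝓙) (hQ : Q.rank = k) (hQV : Q * Vᵀ = 0)
    {J J' : Finset (Fin m)} (hJ : J ∈ 𝓙) (hJ' : J' ∈ 𝓙) {l : Fin k → ℝ}
    (hpos : ∀ i ∉ J, 0 ≤ (l ᵥ* Q) i) (hneg : ∀ i ∉ J', (l ᵥ* Q) i ≤ 0) : l = 0 := by
  obtain ⟨-, -, -, -, -, hind, hinter, -⟩ := hfan
  refine eq_zero_of_vecMul_eq_zero hQ
    (relation_eq_zero (hind J hJ) (hind J' hJ') (hinter J hJ J' hJ') ?_ hpos hneg)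
  have h : (l ᵥ* Q) ᵥ* Vᵀ = 0 := by rw [Matrix.vecMul_vecMul, hQV, Matrix.vecMul_zero]
  funext a
  simpa [Matrix.vecMul, dotProduct, Finset.sum_apply] using congrFun h a

theorem eq_cramer_smul_add_smul {p q : Fin 2 → ℝ} (hdet : p 0 * q 1 - p 1 * q 0 ≠ 0)
    (x : Fin 2 → ℝ) :
    x = ((x 0 * q 1 - x 1 * q 0) / (p 0 * q 1 - p 1 * q 0)) • p +
      ((p 0 * x 1 - p 1 * x 0) / (p 0 * q 1 - p 1 * q 0)) • q := by
  funext a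
  rw [Pi.add_apply, Pi.smul_apply, Pi.smul_apply, smul_eq_mul, smul_eq_mul, div_mul_eq_mul_div,
    div_mul_eq_mul_div, ← add_div, eq_div_iff hdet]
  fin_cases a <;> simp <;> ring

theorem mem_intrinsicInterior_coneOf_pair {m : ℕ} {v : Fin m → (Fin 2 → ℝ)} {i j : Fin m}
    (hij : i ≠ j) (hdet : v i 0 * v j 1 - v i 1 * v j 0 ≠ 0) {x : Fin 2 → ℝ}
    (hi : 0 < (x 0 * v j 1 - x 1 * v j 0) / (v i 0 * v j 1 - v i 1 * v j 0))
    (hj : 0 < (v i 0 * x 1 - v i 1 * x 0) / (v i 0 * v j 1 - v i 1 * v j 0)) :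
    x ∈ intrinsicInterior ℝ (coneOf v {i, j}) := by
  apply interior_subset_intrinsicInterior
  rw [mem_interior]
  refine ⟨{y | 0 < (y 0 * v j 1 - y 1 * v j 0) / (v i 0 * v j 1 - v i 1 * v j 0)} ∩
    {y | 0 < (v i 0 * y 1 - v i 1 * y 0) / (v i 0 * v j 1 - v i 1 * v j 0)}, ?_, ?_, hi, hj⟩
  · rintro y ⟨h1, h2⟩
    refine (mem_coneOf_pair hij).2 ⟨_, _, le_of_lt h1, le_of_lt h2,
      eq_cramer_smul_add_smul hdet y⟩
  · exact (isOpen_lt continuous_const (by fun_prop)).inter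
      (isOpen_lt continuous_const (by fun_prop))

theorem det_ne_zero_of_functional_eq_zero {p q : Fin 2 → ℝ}
    (h : ∀ l : Fin 2 → ℝ, l 0 * p 0 + l 1 * p 1 = 0 → l 0 * q 0 + l 1 * q 1 = 0 → l = 0) :
    p 0 * q 1 - p 1 * q 0 ≠ 0 := by
  intro hdet
  have hp := h ![-p 1, p 0] (by simp; ring) (by simp; linarith)
  have hq := h ![-q 1, q 0] (by simp; linarith) (by simp; ring)
  have hp0 : p 0 = 0 := by simpa using congrFun hp 1
  have hp1 : p 1 = 0 := by simpa using congrFun hp 0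
  have hq0 : q 0 = 0 := by simpa using congrFun hq 1
  have hq1 : q 1 = 0 := by simpa using congrFun hq 0
  simpa using congrFun (h ![1, 0] (by simp [hp0]) (by simp [hq0])) 0

/-- If `e = e₁ p + e₂ q` and `f = f₁ p + f₂ q` lie outside the open quadrant spanned by `p`, `q`,
and no nonzero functional is nonnegative on `p`, `q` and nonpositive on `e`, `f`, then the
matrix of coordinates has an entrywise nonnegative inverse. -/
theorem exists_nonneg_inverse {e₁ e₂ f₁ f₂ : ℝ}
    (h : ∀ a b : ℝ, 0 ≤ a → 0 ≤ b → a * e₁ + b * e₂ ≤ 0 → a * f₁ + b * f₂ ≤ 0 → a = 0 ∧ b = 0)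
    (he : ¬ (0 < e₁ ∧ 0 < e₂)) (hf : ¬ (0 < f₁ ∧ 0 < f₂)) :
    ∃ a b c d : ℝ, 0 ≤ a ∧ 0 ≤ b ∧ 0 ≤ c ∧ 0 ≤ d ∧
      a * e₁ + b * f₁ = 1 ∧ a * e₂ + b * f₂ = 0 ∧ c * e₁ + d * f₁ = 0 ∧ c * e₂ + d * f₂ = 1 := by
  wlog he₁ : 0 < e₁ generalizing e₁ e₂ f₁ f₂
  · have hf₁ : 0 < f₁ := by
      by_contra hf₁
      exact one_ne_zero (h 1 0 zero_le_one le_rfl (by linarith) (by linarith)).1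
    obtain ⟨a, b, c, d, ha, hb, hc, hd, h1, h2, h3, h4⟩ :=
      this (fun a b ha hb hae haf => h a b ha hb haf hae) hf he hf₁
    exact ⟨b, a, d, c, hb, ha, hd, hc, by linarith, by linarith, by linarith, by linarith⟩
  have he₂ : e₂ ≤ 0 := not_lt.1 fun h2 => he ⟨he₁, h2⟩
  have hf₂ : 0 < f₂ := by
    by_contra hf₂
    exact one_ne_zero (h 0 1 le_rfl zero_le_one (by linarith) (by linarith)).2
  have hf₁ : f₁ ≤ 0 := not_lt.1 fun h1 => hf ⟨h1, hf₂⟩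
  have hD : 0 < e₁ * f₂ - e₂ * f₁ := by
    by_contra hD
    exact he₁.ne' (h (-e₂) e₁ (by linarith) he₁.le (by linarith) (by linarith)).2
  have hD' := hD.ne'
  refine ⟨f₂ / (e₁ * f₂ - e₂ * f₁), -e₂ / (e₁ * f₂ - e₂ * f₁), -f₁ / (e₁ * f₂ - e₂ * f₁),
    e₁ / (e₁ * f₂ - e₂ * f₁), div_nonneg hf₂.le hD.le, div_nonneg (by linarith) hD.le,
    div_nonneg (by linarith) hD.le, div_nonneg he₁.le hD.le, ?_, ?_, ?_, ?_⟩ <;>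
  rw [div_mul_eq_mul_div, div_mul_eq_mul_div, ← add_div]
  · rw [div_eq_one_iff_eq hD']; ring
  · rw [div_eq_zero_iff]; left; ring
  · rw [div_eq_zero_iff]; left; ring
  · rw [div_eq_one_iff_eq hD']; ring

/-- In the plane, a nondegenerate cone on two generators is contained in every cone on two
generators that lie outside its interior and that no functional weakly separates from it. -/
theorem coneOf_pair_subset {m : ℕ} {v : Fin m → (Fin 2 → ℝ)} {i j k l : Fin m}
    (hij : i ≠ j) (hkl : k ≠ l) (hdet : v i 0 * v j 1 - v i 1 * v j 0 ≠ 0)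
    (hsep : ∀ φ : Fin 2 → ℝ, 0 ≤ φ 0 * v i 0 + φ 1 * v i 1 → 0 ≤ φ 0 * v j 0 + φ 1 * v j 1 →
      φ 0 * v k 0 + φ 1 * v k 1 ≤ 0 → φ 0 * v l 0 + φ 1 * v l 1 ≤ 0 → φ = 0)
    (hk : v k ∉ intrinsicInterior ℝ (coneOf v {i, j}))
    (hl : v l ∉ intrinsicInterior ℝ (coneOf v {i, j})) :
    coneOf v {i, j} ⊆ coneOf v {k, l} := by
  set D := v i 0 * v j 1 - v i 1 * v j 0 with hD
  have coord : ∀ x : Fin 2 → ℝ, x = ((x 0 * v j 1 - x 1 * v j 0) / D) • v i +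
      ((v i 0 * x 1 - v i 1 * x 0) / D) • v j :=
    eq_cramer_smul_add_smul hdet
  have hk' := fun h : _ ∧ _ => hk (mem_intrinsicInterior_coneOf_pair hij hdet h.1 h.2)
  have hl' := fun h : _ ∧ _ => hl (mem_intrinsicInterior_coneOf_pair hij hdet h.1 h.2)
  obtain ⟨a, b, c, d, ha, hb, hc, hd, h1, h2, h3, h4⟩ :=
      exists_nonneg_inverse (fun s t hs ht he hf => by
    have key : ∀ x : Fin 2 → ℝ,
        (s * v j 1 - t * v i 1) / D * x 0 + (t * v i 0 - s * v j 0) / D * x 1 =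
        s * ((x 0 * v j 1 - x 1 * v j 0) / D) + t * ((v i 0 * x 1 - v i 1 * x 0) / D) :=
      fun x => by ring
    have hi : (s * v j 1 - t * v i 1) / D * v i 0 + (t * v i 0 - s * v j 0) / D * v i 1 = s := by
      field_simp; rw [hD]; ring
    have hj : (s * v j 1 - t * v i 1) / D * v j 0 + (t * v i 0 - s * v j 0) / D * v j 1 = t := by
      field_simp; rw [hD]; ring
    have h0 := hsep ![(s * v j 1 - t * v i 1) / D, (t * v i 0 - s * v j 0) / D]
      (by simpa [hi] using hs) (by simpa [hj] using ht)
      (by simpa [key] using he) (by simpa [key] using hf)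
    have h00 : (s * v j 1 - t * v i 1) / D = 0 := by simpa only [cons_val_zero, Pi.zero_apply] using congrFun h0 0
    have h01 : (t * v i 0 - s * v j 0) / D = 0 := by simpa only [cons_val_one, cons_val_zero, cons_val_fin_one, Pi.zero_apply] using congrFun h0 1
    rw [h00, h01] at hi hj
    exact ⟨by linarith, by linarith⟩) hk' hl'
  have combine : ∀ y z : ℝ, y • v k + z • v l =
      (y * ((v k 0 * v j 1 - v k 1 * v j 0) / D) + z * ((v l 0 * v j 1 - v l 1 * v j 0) / D)) • v i +
      (y * ((v i 0 * v k 1 - v i 1 * v k 0) / D) + z * ((v i 0 * v l 1 - v i 1 * v l 0) / D)) • v j := by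
    intro y z
    conv_lhs => rw [coord (v k), coord (v l)]
    module
  intro x hx
  obtain ⟨s, t, hs, ht, rfl⟩ := (mem_coneOf_pair hij).1 hx
  refine (mem_coneOf_pair hkl).2 ⟨s * a + t * c, s * b + t * d, by positivity, by positivity, ?_⟩
  have hvi := combine a b
  have hvj := combine c d
  rw [h1, h2, one_smul, zero_smul, add_zero] at hvi
  rw [h3, h4, one_smul, zero_smul, zero_add] at hvj
  rw [← hvi, ← hvj]
  module


theorem stmt_7 {n : ℕ} (hn : 1 ≤ n) {m : ℕ} (hm : m = n + 2)
    (V : Matrix (Fin n) (Fin m) ℝ) (Q : Matrix (Fin 2) (Fin m) ℝ)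
    (𝓙 : Set (Finset (Fin m)))
    (hfan : IsSimplicialCompleteFan (fun i a => V a i) 𝓙)
    (hQrank : Q.rank = 2) (hQV : Q * Vᵀ = 0)
    (𝓘 : Set (Finset (Fin m))) (h𝓘 : 𝓘 = {I | ∃ J ∈ 𝓙, I = Jᶜ})
    (I₀ : Finset (Fin m)) (hI₀ : I₀ ∈ 𝓘)
    (hmin : ∀ i : Fin m,
      (fun a => Q a i) ∉ intrinsicInterior ℝ (coneOf (fun i a => Q a i) I₀)) :
    ∀ I ∈ 𝓘, coneOf (fun i a => Q a i) I₀ ⊆ coneOf (fun i a => Q a i) I := by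
  subst h𝓘
  obtain ⟨J₀, hJ₀, rfl⟩ := hI₀
  rintro _ ⟨J, hJ, rfl⟩
  have hcard : ∀ K ∈ 𝓙, (Kᶜ).card = 2 := fun K hK => by
    rw [Finset.card_compl, Fintype.card_fin, hfan.2.2.2.1 K hK, hm]
    omega
  obtain ⟨i, j, hij, h₀⟩ := Finset.card_eq_two.1 (hcard J₀ hJ₀)
  obtain ⟨k, l, hkl, h₁⟩ := Finset.card_eq_two.1 (hcard J hJ)
  have mem₀ : ∀ x ∉ J₀, x = i ∨ x = j := fun x hx => by
    simpa [h₀] using Finset.mem_compl.2 hx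
  have mem₁ : ∀ x ∉ J, x = k ∨ x = l := fun x hx => by
    simpa [h₁] using Finset.mem_compl.2 hx
  have hmul : ∀ (φ : Fin 2 → ℝ) x, (φ ᵥ* Q) x = φ 0 * Q 0 x + φ 1 * Q 1 x := fun φ x => by
    simp [Matrix.vecMul, dotProduct]
  rw [h₀] at hmin ⊢
  rw [h₁]
  refine coneOf_pair_subset hij hkl
    (det_ne_zero_of_functional_eq_zero (p := fun a => Q a i) (q := fun a => Q a j)
      fun φ hi hj => ?_)
    (fun φ hi hj hk hl => ?_) (hmin k) (hmin l)
  · refine gale_functional_eq_zero hfan hQrank hQV hJ₀ hJ₀ (fun x hx => ?_) (fun x hx => ?_)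
    · rw [hmul]
      rcases mem₀ x hx with rfl | rfl
      exacts [hi.ge, hj.ge]
    · rw [hmul]
      rcases mem₀ x hx with rfl | rfl
      exacts [hi.le, hj.le]
  · refine gale_functional_eq_zero hfan hQrank hQV hJ₀ hJ (fun x hx => ?_) (fun x hx => ?_)
    · rw [hmul]
      rcases mem₀ x hx with rfl | rfl
      exacts [hi, hj]
    · rw [hmul]
      rcases mem₁ x hx with rfl | rfl
      exacts [hk, hl]
end

section
/- (Gale duality for nonsingular submatrices.) Let n, r ≥ 1, m = n + r, let V be an n×m real matrix of rank n with columns v_1, …, v_m, and let Q be an r×m real matrix of rank r with Q·Vᵀ = 0. Let J ⊆ {1, …, m} with |J| = n and let I = {1, …, m} \ J be its complement. Then the columns {v_j : j ∈ J} of V are linearly independent if and only if the columns {q_i : i ∈ I} of Q are linearly independent. -/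
open Matrix

/-- The rows of a matrix are linearly independent iff its rank is the number of rows. -/
theorem Matrix.linearIndependent_row_iff_rank_eq {K p ι : Type*} [Field K] [Fintype p] [Fintype ι]
    (A : Matrix p ι K) : LinearIndependent K A.row ↔ A.rank = Fintype.card p := by
  rw [linearIndependent_iff_card_eq_finrank_span, Matrix.rank_eq_finrank_span_row, eq_comm]
  rfl

/-- If `B * Aᵀ = 0`, the rows of `B` are linearly independent, and the columns of `A` indexed by
`S` are linearly independent, then the columns of `B` indexed by the complement of `S` are linearly
independent as soon as they are as many as the rows of `B`. -/
theorem Matrix.linearIndependent_col_compl_of_mul_transpose_eq_zero {K p q ι : Type*} [Field K]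
    [Fintype q] [Fintype ι] [DecidableEq ι] {A : Matrix p ι K} {B : Matrix q ι K}
    (hBA : B * Aᵀ = 0) (hB : LinearIndependent K B.row) {S : Finset ι}
    (hS : Sᶜ.card = Fintype.card q) (hA : LinearIndependent K fun j : S => A.col j) :
    LinearIndependent K fun i : (Sᶜ : Finset ι) => B.col i := by
  let C : Matrix q (Sᶜ : Finset ι) K := B.submatrix id Subtype.val
  have hrow : LinearIndependent K C.row := by
    rw [← Matrix.vecMul_injective_iff] at hB
    rw [Fintype.linearIndependent_iff]
    intro y hy
    have hcompl : ∀ i ∉ S, (y ᵥ* B) i = 0 := fun i hi => by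
      simpa [C, Matrix.vecMul, dotProduct] using
        congrFun hy (⟨i, Finset.mem_compl.2 hi⟩ : (Sᶜ : Finset ι))
    have hker : (y ᵥ* B) ᵥ* Aᵀ = 0 := by rw [Matrix.vecMul_vecMul, hBA, Matrix.vecMul_zero]
    have hmem : ∀ j : S, (y ᵥ* B) j = 0 := by
      refine Fintype.linearIndependent_iff.1 hA (fun j => (y ᵥ* B) j) ?_
      ext a
      rw [Finset.sum_apply, ← congrFun hker a]
      simp only [Pi.smul_apply, smul_eq_mul, Matrix.col_apply]
      rw [Finset.sum_coe_sort S fun i => (y ᵥ* B) i * A a i]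
      exact Finset.sum_subset (Finset.subset_univ S) fun i _ hi => by rw [hcompl i hi, zero_mul]
    have hzero : y ᵥ* B = 0 ᵥ* B := by
      rw [Matrix.zero_vecMul]
      ext i
      by_cases hi : i ∈ S
      · exact hmem ⟨i, hi⟩
      · exact hcompl i hi
    exact congrFun (hB hzero)
  have hcol : LinearIndependent K Cᵀ.row := by
    rw [Matrix.linearIndependent_row_iff_rank_eq] at hrow ⊢
    rw [Matrix.rank_transpose, hrow, Fintype.card_coe, hS]
  exact hcol

/-- Gale duality for nonsingular submatrices: given an `n × m` matrix `V` of rank `n`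
and a Gale dual `r × m` matrix `Q` of rank `r` (with `m = n + r` and `Q * Vᵀ = 0`),
the columns of `V` indexed by an `n`-element set `J` are linearly independent iff the
columns of `Q` indexed by the complement of `J` are linearly independent. -/
theorem stmt_9 {n r : ℕ} (hn : 1 ≤ n) (hr : 1 ≤ r) {m : ℕ} (hm : m = n + r)
    (V : Matrix (Fin n) (Fin m) ℝ) (Q : Matrix (Fin r) (Fin m) ℝ)
    (hVrank : V.rank = n) (hQrank : Q.rank = r) (hQV : Q * Vᵀ = 0)
    (J : Finset (Fin m)) (hJcard : J.card = n) :
    LinearIndependent ℝ (fun j : J => fun a => V a j) ↔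
      LinearIndependent ℝ (fun i : (Jᶜ : Finset (Fin m)) => fun a => Q a i) := by
  have hVQ : V * Qᵀ = 0 := by simpa using congrArg Matrix.transpose hQV
  constructor
  · refine Matrix.linearIndependent_col_compl_of_mul_transpose_eq_zero hQV ?_ ?_
    · simpa [Matrix.linearIndependent_row_iff_rank_eq] using hQrank
    · simp [Finset.card_compl, hJcard, hm]
  · intro h
    have key := Matrix.linearIndependent_col_compl_of_mul_transpose_eq_zero (S := Jᶜ) hVQ
      (by simpa [Matrix.linearIndependent_row_iff_rank_eq] using hVrank) (by simp [hJcard]) h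
    rw [compl_compl] at key
    exact key
end

section
/- Let v_1 = (1,0,0), v_2 = (0,1,0), v_3 = (0,0,1), v_4 = (0,-1,-1), v_5 = (-1,-1,0), v_6 = (1,3,2) in ℝ³ (the columns of the fan matrix V of the example). For S ⊆ {1,…,6} let σ_S denote the set of all nonnegative linear combinations of {v_j : j ∈ S}. Then the eight simplicial cones of the fan Σ₈, namely σ_{{2,4,5}}, σ_{{2,3,5}}, σ_{{1,4,5}}, σ_{{1,3,5}}, σ_{{2,4,6}}, σ_{{2,3,6}}, σ_{{1,4,6}}, σ_{{1,3,6}}, cover ℝ³: their union equals ℝ³; moreover for each of these eight index sets the corresponding three vectors are linearly independent. -/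
/-- The cone in ℝ³ generated by three vectors: all their nonnegative linear combinations. -/
def cone3 (a b c : Fin 3 → ℝ) : Set (Fin 3 → ℝ) :=
  {x | ∃ l p q : ℝ, 0 ≤ l ∧ 0 ≤ p ∧ 0 ≤ q ∧ x = l • a + p • b + q • c}

/-- Membership in `cone3` from explicit nonnegative coefficients, checked coordinatewise. -/
theorem mem_cone3_of_coord {a b c x : Fin 3 → ℝ} (l p q : ℝ) (hl : 0 ≤ l) (hp : 0 ≤ p)
    (hq : 0 ≤ q) (h : ∀ i, x i = l * a i + p * b i + q * c i) : x ∈ cone3 a b c :=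
  ⟨l, p, q, hl, hp, hq, funext fun i => by simpa using h i⟩

/-- Three vectors of `ℝ³` with nonzero triple product are linearly independent. -/
theorem linearIndependent_of_tripleProduct_ne_zero {a b c : Fin 3 → ℝ}
    (h : a 0 * (b 1 * c 2 - b 2 * c 1) - a 1 * (b 0 * c 2 - b 2 * c 0) +
      a 2 * (b 0 * c 1 - b 1 * c 0) ≠ 0) : LinearIndependent ℝ ![a, b, c] := by
  refine Matrix.linearIndependent_rows_of_det_ne_zero (A := Matrix.of ![a, b, c]) ?_
  have hdet : (Matrix.of ![a, b, c]).det = a 0 * (b 1 * c 2 - b 2 * c 1) -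
      a 1 * (b 0 * c 2 - b 2 * c 0) + a 2 * (b 0 * c 1 - b 1 * c 0) :=
    (Matrix.det_fin_three _).trans (by simp only [Matrix.of_apply, Matrix.cons_val]; ring)
  rwa [hdet]

/-- The eight simplicial cones of the fan Σ₈ (of the 3-dimensional ℚ-factorial complete
toric variety of Picard number 3 with trivial nef cone) cover ℝ³, and each of the eight
generating triples of columns of the fan matrix V is linearly independent. -/
theorem stmt_10 (v1 v2 v3 v4 v5 v6 : Fin 3 → ℝ)
    (h1 : v1 = ![1, 0, 0]) (h2 : v2 = ![0, 1, 0]) (h3 : v3 = ![0, 0, 1])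
    (h4 : v4 = ![0, -1, -1]) (h5 : v5 = ![-1, -1, 0]) (h6 : v6 = ![1, 3, 2]) :
    (cone3 v2 v4 v5 ∪ cone3 v2 v3 v5 ∪ cone3 v1 v4 v5 ∪ cone3 v1 v3 v5 ∪
      cone3 v2 v4 v6 ∪ cone3 v2 v3 v6 ∪ cone3 v1 v4 v6 ∪ cone3 v1 v3 v6 = Set.univ) ∧
    LinearIndependent ℝ ![v2, v4, v5] ∧ LinearIndependent ℝ ![v2, v3, v5] ∧
    LinearIndependent ℝ ![v1, v4, v5] ∧ LinearIndependent ℝ ![v1, v3, v5] ∧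
    LinearIndependent ℝ ![v2, v4, v6] ∧ LinearIndependent ℝ ![v2, v3, v6] ∧
    LinearIndependent ℝ ![v1, v4, v6] ∧ LinearIndependent ℝ ![v1, v3, v6] := by
  subst h1 h2 h3 h4 h5 h6
  refine ⟨Set.eq_univ_of_forall fun w => ?_, ?_⟩
  · obtain ⟨x, hx⟩ : ∃ x, x = w 0 := ⟨_, rfl⟩
    obtain ⟨y, hy⟩ : ∃ y, y = w 1 := ⟨_, rfl⟩
    obtain ⟨z, hz⟩ : ∃ z, z = w 2 := ⟨_, rfl⟩
    have h245 (hl : 0 ≤ y - x - z) (hp : 0 ≤ -z) (hq : 0 ≤ -x) :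
        w ∈ cone3 ![0, 1, 0] ![0, -1, -1] ![-1, -1, 0] := by
      refine mem_cone3_of_coord _ _ _ hl hp hq fun i => ?_
      fin_cases i <;> simp [← hx, ← hy, ← hz]
    have h235 (hl : 0 ≤ y - x) (hp : 0 ≤ z) (hq : 0 ≤ -x) :
        w ∈ cone3 ![0, 1, 0] ![0, 0, 1] ![-1, -1, 0] := by
      refine mem_cone3_of_coord _ _ _ hl hp hq fun i => ?_
      fin_cases i <;> simp [← hx, ← hy, ← hz]
    have h145 (hl : 0 ≤ x + z - y) (hp : 0 ≤ -z) (hq : 0 ≤ z - y) :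
        w ∈ cone3 ![1, 0, 0] ![0, -1, -1] ![-1, -1, 0] := by
      refine mem_cone3_of_coord _ _ _ hl hp hq fun i => ?_
      fin_cases i <;> simp [← hx, ← hy, ← hz]
    have h135 (hl : 0 ≤ x - y) (hp : 0 ≤ z) (hq : 0 ≤ -y) :
        w ∈ cone3 ![1, 0, 0] ![0, 0, 1] ![-1, -1, 0] := by
      refine mem_cone3_of_coord _ _ _ hl hp hq fun i => ?_
      fin_cases i <;> simp [← hx, ← hy, ← hz]
    have h246 (hl : 0 ≤ y - x - z) (hp : 0 ≤ 2 * x - z) (hq : 0 ≤ x) :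
        w ∈ cone3 ![0, 1, 0] ![0, -1, -1] ![1, 3, 2] := by
      refine mem_cone3_of_coord _ _ _ hl hp hq fun i => ?_
      fin_cases i <;> simp [← hx, ← hy, ← hz] <;> ring
    have h236 (hl : 0 ≤ y - 3 * x) (hp : 0 ≤ z - 2 * x) (hq : 0 ≤ x) :
        w ∈ cone3 ![0, 1, 0] ![0, 0, 1] ![1, 3, 2] := by
      refine mem_cone3_of_coord _ _ _ hl hp hq fun i => ?_
      fin_cases i <;> simp [← hx, ← hy, ← hz] <;> ring
    have h146 (hl : 0 ≤ x - y + z) (hp : 0 ≤ 2 * y - 3 * z) (hq : 0 ≤ y - z) :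
        w ∈ cone3 ![1, 0, 0] ![0, -1, -1] ![1, 3, 2] := by
      refine mem_cone3_of_coord _ _ _ hl hp hq fun i => ?_
      fin_cases i <;> simp [← hx, ← hy, ← hz] <;> ring
    have h136 (hl : 0 ≤ x - y / 3) (hp : 0 ≤ z - 2 * y / 3) (hq : 0 ≤ y / 3) :
        w ∈ cone3 ![1, 0, 0] ![0, 0, 1] ![1, 3, 2] := by
      refine mem_cone3_of_coord _ _ _ hl hp hq fun i => ?_
      fin_cases i <;> simp [← hx, ← hy, ← hz]
      ring
    simp only [Set.mem_union]
    grind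
  · refine ⟨?_, ?_, ?_, ?_, ?_, ?_, ?_, ?_⟩ <;>
      exact linearIndependent_of_tripleProduct_ne_zero (by simp <;> norm_num)
end

section
/- Let q_1 = (1,0,0), q_2 = (1,1,0), q_3 = (0,1,0), q_4 = (0,1,2), q_5 = (1,0,1), q_6 = (0,0,1) in ℝ³ (the columns of the weight matrix Q of the example). Then the intersection of the eight cones generated respectively by {q_1,q_3,q_6}, {q_1,q_4,q_6}, {q_2,q_3,q_6}, {q_2,q_4,q_6}, {q_1,q_3,q_5}, {q_1,q_4,q_5}, {q_2,q_3,q_5}, {q_2,q_4,q_5} equals {0}. (This is the statement Nef(X(Σ₈)) = 0 for the ℚ-factorial complete 3-dimensional toric variety X(Σ₈) of Picard number 3, showing the bound Nef(X)=0 ⇒ rank ≥ 3 is sharp.) -/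
/-- The intersection of the eight cones of the bunch 𝓑_{Σ₈} is trivial:
Nef(X(Σ₈)) = 0 for the ℚ-factorial complete 3-dimensional toric variety X(Σ₈) of
Picard number 3. -/
theorem stmt_11 (q1 q2 q3 q4 q5 q6 : Fin 3 → ℝ)
    (h1 : q1 = ![1, 0, 0]) (h2 : q2 = ![1, 1, 0]) (h3 : q3 = ![0, 1, 0])
    (h4 : q4 = ![0, 1, 2]) (h5 : q5 = ![1, 0, 1]) (h6 : q6 = ![0, 0, 1]) :
    cone3 q1 q3 q6 ∩ cone3 q1 q4 q6 ∩ cone3 q2 q3 q6 ∩ cone3 q2 q4 q6 ∩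
      cone3 q1 q3 q5 ∩ cone3 q1 q4 q5 ∩ cone3 q2 q3 q5 ∩ cone3 q2 q4 q5 = {0} := by
  subst h1 h2 h3 h4 h5 h6
  apply Set.Subset.antisymm
  · rintro x ⟨⟨⟨⟨⟨⟨⟨-, h146⟩, h236⟩, -⟩, h135⟩, -⟩, -⟩, -⟩
    obtain ⟨a, b, c, ha, hb, hc, h⟩ := h146
    obtain ⟨a', b', c', ha', hb', hc', h'⟩ := h236
    obtain ⟨d, e, f, hd, he, hf, h''⟩ := h135
    have coord (i : Fin 3) := And.intro (congrFun h i) (And.intro (congrFun h' i) (congrFun h'' i))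
    have h₀ := coord 0
    have h₁ := coord 1
    have h₂ := coord 2
    simp at h₀ h₁ h₂
    obtain ⟨h₀, h₀', h₀''⟩ := h₀
    obtain ⟨h₁, h₁', h₁''⟩ := h₁
    obtain ⟨h₂, h₂', h₂''⟩ := h₂
    -- The three cones give `2 * x 1 ≤ x 2`, `x 0 ≤ x 1` and `x 2 ≤ x 0`.
    rw [Set.mem_singleton_iff]
    ext i
    fin_cases i <;> simp <;> linarith
  · rintro x rfl
    have zero_mem (a b c : Fin 3 → ℝ) : (0 : Fin 3 → ℝ) ∈ cone3 a b c :=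
      ⟨0, 0, 0, le_rfl, le_rfl, le_rfl, by simp⟩
    simp only [Set.mem_inter_iff, zero_mem, and_self]
end

section
/- Let t ≥ 2 be an integer and let q_1 = (1,0,0), q_2 = (1,1,0), q_3 = (0,1,0), q_4 = (0,1,t), q_5 = (1,0,1), q_6 = (0,0,1) in ℝ³ (the columns of the weight matrix Q_t). Then the intersection of the eight cones generated respectively by {q_1,q_3,q_6}, {q_1,q_4,q_6}, {q_2,q_3,q_6}, {q_2,q_4,q_6}, {q_1,q_3,q_5}, {q_1,q_4,q_5}, {q_2,q_3,q_5}, {q_2,q_4,q_5} equals {0}. (This gives an infinite family of ℚ-factorial complete non-projective 3-dimensional toric varieties of Picard number 3 with trivial nef cone.) -/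
theorem zero_mem_cone3 (a b c : Fin 3 → ℝ) : (0 : Fin 3 → ℝ) ∈ cone3 a b c :=
  ⟨0, 0, 0, le_rfl, le_rfl, le_rfl, by simp⟩

/-- For every integer t ≥ 2, the intersection of the eight cones of the bunch associated
with the weight matrix Q_t is trivial: an infinite family of ℚ-factorial complete
non-projective 3-dimensional toric varieties of Picard number 3 with trivial nef cone. -/
theorem stmt_12 (t : ℤ) (ht : 2 ≤ t) (q1 q2 q3 q4 q5 q6 : Fin 3 → ℝ)
    (h1 : q1 = ![1, 0, 0]) (h2 : q2 = ![1, 1, 0]) (h3 : q3 = ![0, 1, 0])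
    (h4 : q4 = ![0, 1, (t : ℝ)]) (h5 : q5 = ![1, 0, 1]) (h6 : q6 = ![0, 0, 1]) :
    cone3 q1 q3 q6 ∩ cone3 q1 q4 q6 ∩ cone3 q2 q3 q6 ∩ cone3 q2 q4 q6 ∩
      cone3 q1 q3 q5 ∩ cone3 q1 q4 q5 ∩ cone3 q2 q3 q5 ∩ cone3 q2 q4 q5 = {0} := by
  have ht' : (2 : ℝ) ≤ t := by exact_mod_cast ht
  apply Set.Subset.antisymm
  · rintro x ⟨⟨⟨⟨⟨⟨⟨-, h146⟩, h236⟩, -⟩, h135⟩, -⟩, -⟩, -⟩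
    subst h1 h2 h3 h4 h5 h6
    have hca : 0 ≤ x 2 ∧ x 2 ≤ x 0 := by
      obtain ⟨l, p, q, hl, hp, hq, rfl⟩ := h135
      simp [hl, hq]
    have hab : x 0 ≤ x 1 := by
      obtain ⟨l, p, q, hl, hp, hq, rfl⟩ := h236
      simp [hp]
    have hbc : 0 ≤ x 1 ∧ t * x 1 ≤ x 2 := by
      obtain ⟨l, p, q, hl, hp, hq, rfl⟩ := h146
      simp [hp, hq, mul_comm]
    have hb : 2 * x 1 ≤ t * x 1 := mul_le_mul_of_nonneg_right ht' hbc.1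
    rw [Set.mem_singleton_iff]
    ext i
    fin_cases i <;> simp <;> linarith [hca.1, hca.2, hbc.1, hbc.2]
  · rintro x rfl
    simp only [Set.mem_inter_iff, zero_mem_cone3, and_self]
end

section
/- (Berchtold–Hausen example.) Let q_1 = (1,0,0), q_2 = (1,1,0), q_3 = (0,1,0), q_4 = (0,1,1), q_5 = (1,0,1), q_6 = (0,0,1) in ℝ³ (the columns of the weight matrix Q_{BH}). Then the intersection of the eight cones of the bunch 𝓑, generated respectively by {q_1,q_3,q_6}, {q_1,q_4,q_6}, {q_2,q_3,q_6}, {q_2,q_4,q_6}, {q_1,q_3,q_5}, {q_1,q_4,q_5}, {q_2,q_3,q_5}, {q_2,q_4,q_5}, equals the ray {λ·(1,1,1) : λ ∈ ℝ, λ ≥ 0}. (This is the statement that Nef(X) is the 1-dimensional cone generated by the anti-canonical class.) -/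
/-- Berchtold–Hausen example: the intersection of the eight cones of the bunch 𝓑 is the
ray generated by (1,1,1), i.e. Nef(X) is the 1-dimensional cone generated by the
anti-canonical class. -/
theorem stmt_13 (q1 q2 q3 q4 q5 q6 : Fin 3 → ℝ)
    (h1 : q1 = ![1, 0, 0]) (h2 : q2 = ![1, 1, 0]) (h3 : q3 = ![0, 1, 0])
    (h4 : q4 = ![0, 1, 1]) (h5 : q5 = ![1, 0, 1]) (h6 : q6 = ![0, 0, 1]) :
    cone3 q1 q3 q6 ∩ cone3 q1 q4 q6 ∩ cone3 q2 q3 q6 ∩ cone3 q2 q4 q6 ∩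
      cone3 q1 q3 q5 ∩ cone3 q1 q4 q5 ∩ cone3 q2 q3 q5 ∩ cone3 q2 q4 q5 =
      {x | ∃ l : ℝ, 0 ≤ l ∧ x = l • (![1, 1, 1] : Fin 3 → ℝ)} := by
  subst h1 h2 h3 h4 h5 h6
  ext x
  constructor
  · rintro ⟨⟨⟨⟨⟨⟨⟨-, l, p, q, hl, hp, hq, h146⟩, l', p', q', hl', hp', hq', h236⟩, -⟩,
      l'', p'', q'', hl'', hp'', hq'', h135⟩, -⟩, -⟩, -⟩
    have hyz : x 1 ≤ x 2 := by simp [h146, hq]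
    have hxy : x 0 ≤ x 1 := by simp [h236, hp']
    have hzx : x 2 ≤ x 0 := by simp [h135, hl'']
    refine ⟨x 0, by simp [h146, hl], ?_⟩
    ext i
    fin_cases i <;> simp <;> linarith
  · rintro ⟨t, ht, rfl⟩
    refine ⟨⟨⟨⟨⟨⟨⟨⟨t, t, t, ht, ht, ht, ?_⟩, ⟨t, t, 0, ht, ht, le_rfl, ?_⟩⟩,
      ⟨t, 0, t, ht, le_rfl, ht, ?_⟩⟩, ⟨t, 0, t, ht, le_rfl, ht, ?_⟩⟩,
      ⟨0, t, t, le_rfl, ht, ht, ?_⟩⟩, ⟨t, t, 0, ht, ht, le_rfl, ?_⟩⟩,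
      ⟨0, t, t, le_rfl, ht, ht, ?_⟩⟩,
      ⟨t / 2, t / 2, t / 2, by positivity, by positivity, by positivity, ?_⟩⟩ <;> simp
end

section
/- (Berchtold–Hausen example, symmetric fan.) Let q_1 = (1,0,0), q_2 = (1,1,0), q_3 = (0,1,0), q_4 = (0,1,1), q_5 = (1,0,1), q_6 = (0,0,1) in ℝ³ (the columns of the weight matrix Q_{BH}). Then the intersection of the eight cones of the bunch 𝓑', generated respectively by {q_1,q_2,q_6}, {q_1,q_3,q_6}, {q_1,q_2,q_4}, {q_1,q_3,q_4}, {q_2,q_5,q_6}, {q_3,q_5,q_6}, {q_2,q_4,q_5}, {q_3,q_4,q_5}, equals the ray {λ·(1,1,1) : λ ∈ ℝ, λ ≥ 0}. (This is the statement that Nef(X') is the 1-dimensional cone generated by the anti-canonical class.) -/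
/-- Berchtold–Hausen example, symmetric fan: the intersection of the eight cones of the
bunch 𝓑' is the ray generated by (1,1,1), i.e. Nef(X') is the 1-dimensional cone
generated by the anti-canonical class. -/
theorem stmt_14 (q1 q2 q3 q4 q5 q6 : Fin 3 → ℝ)
    (h1 : q1 = ![1, 0, 0]) (h2 : q2 = ![1, 1, 0]) (h3 : q3 = ![0, 1, 0])
    (h4 : q4 = ![0, 1, 1]) (h5 : q5 = ![1, 0, 1]) (h6 : q6 = ![0, 0, 1]) :
    cone3 q1 q2 q6 ∩ cone3 q1 q3 q6 ∩ cone3 q1 q2 q4 ∩ cone3 q1 q3 q4 ∩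
      cone3 q2 q5 q6 ∩ cone3 q3 q5 q6 ∩ cone3 q2 q4 q5 ∩ cone3 q3 q4 q5 =
      {x | ∃ l : ℝ, 0 ≤ l ∧ x = l • (![1, 1, 1] : Fin 3 → ℝ)} := by
  subst h1 h2 h3 h4 h5 h6
  ext x
  constructor
  · rintro ⟨⟨⟨⟨⟨⟨⟨h126, -⟩, -⟩, h134⟩, -⟩, h356⟩, -⟩, -⟩
    obtain ⟨a, b, c, ha, hb, hc, h126⟩ := h126
    obtain ⟨a', b', c', ha', hb', hc', h134⟩ := h134
    obtain ⟨a'', b'', c'', ha'', hb'', hc'', h356⟩ := h356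
    simp only [funext_iff, Fin.forall_fin_succ] at h126 h134 h356
    simp at h126 h134 h356
    refine ⟨x 0, by linarith, ?_⟩
    ext i
    fin_cases i <;> simp <;> linarith
  · rintro ⟨l, hl, rfl⟩
    have hl2 : 0 ≤ l / 2 := by positivity
    refine ⟨⟨⟨⟨⟨⟨⟨⟨0, l, l, le_rfl, hl, hl, ?_⟩, ⟨l, l, l, hl, hl, hl, ?_⟩⟩,
      ⟨l, 0, l, hl, le_rfl, hl, ?_⟩⟩, ⟨l, 0, l, hl, le_rfl, hl, ?_⟩⟩,
      ⟨l, 0, l, hl, le_rfl, hl, ?_⟩⟩, ⟨l, l, 0, hl, hl, le_rfl, ?_⟩⟩,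
      ⟨l / 2, l / 2, l / 2, hl2, hl2, hl2, ?_⟩⟩, ⟨l, 0, l, hl, le_rfl, hl, ?_⟩⟩ <;>
    · ext i
      fin_cases i <;> simp
end

section
/- (Berchtold–Hausen example, fan completeness.) Let v_1 = (1,0,0), v_2 = (0,1,0), v_3 = (0,0,1), v_4 = (0,-1,-1), v_5 = (-1,-1,0), v_6 = (1,2,1) in ℝ³ (the columns of the fan matrix V_{BH}). For S ⊆ {1,…,6} let σ_S denote the set of all nonnegative linear combinations of {v_j : j ∈ S}. Then the eight simplicial cones of the fan Σ, namely σ_{{2,4,5}}, σ_{{2,3,5}}, σ_{{1,4,5}}, σ_{{1,3,5}}, σ_{{2,4,6}}, σ_{{2,3,6}}, σ_{{1,4,6}}, σ_{{1,3,6}}, cover ℝ³: their union equals ℝ³; moreover for each of these eight index sets the corresponding three vectors are linearly independent. -/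
/-- Membership in `cone3` of explicit vectors, checked coordinatewise. -/
theorem mem_cone3_of_coords {a b c v : Fin 3 → ℝ} {l p q : ℝ} (hl : 0 ≤ l) (hp : 0 ≤ p)
    (hq : 0 ≤ q) (h0 : v 0 = l * a 0 + p * b 0 + q * c 0)
    (h1 : v 1 = l * a 1 + p * b 1 + q * c 1) (h2 : v 2 = l * a 2 + p * b 2 + q * c 2) :
    v ∈ cone3 a b c := by
  refine ⟨l, p, q, hl, hp, hq, ?_⟩
  ext i
  fin_cases i <;> simpa

/-- Three vectors of `ℝ³` whose matrix has nonzero determinant are linearly independent. -/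
theorem linearIndependent_of_det_ne_zero {a b c : Fin 3 → ℝ}
    (h : (Matrix.of ![a, b, c]).det ≠ 0) : LinearIndependent ℝ ![a, b, c] :=
  Matrix.linearIndependent_rows_of_det_ne_zero h

/-- Berchtold–Hausen example, fan completeness: the eight simplicial cones of the fan Σ
(with fan matrix V_{BH}) cover ℝ³, and each of the eight generating triples is linearly
independent. -/
theorem stmt_15 (v1 v2 v3 v4 v5 v6 : Fin 3 → ℝ)
    (h1 : v1 = ![1, 0, 0]) (h2 : v2 = ![0, 1, 0]) (h3 : v3 = ![0, 0, 1])
    (h4 : v4 = ![0, -1, -1]) (h5 : v5 = ![-1, -1, 0]) (h6 : v6 = ![1, 2, 1]) :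
    (cone3 v2 v4 v5 ∪ cone3 v2 v3 v5 ∪ cone3 v1 v4 v5 ∪ cone3 v1 v3 v5 ∪
      cone3 v2 v4 v6 ∪ cone3 v2 v3 v6 ∪ cone3 v1 v4 v6 ∪ cone3 v1 v3 v6 = Set.univ) ∧
    LinearIndependent ℝ ![v2, v4, v5] ∧ LinearIndependent ℝ ![v2, v3, v5] ∧
    LinearIndependent ℝ ![v1, v4, v5] ∧ LinearIndependent ℝ ![v1, v3, v5] ∧
    LinearIndependent ℝ ![v2, v4, v6] ∧ LinearIndependent ℝ ![v2, v3, v6] ∧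
    LinearIndependent ℝ ![v1, v4, v6] ∧ LinearIndependent ℝ ![v1, v3, v6] := by
  subst h1 h2 h3 h4 h5 h6
  refine ⟨Set.eq_univ_of_forall fun v => ?_, ?_⟩
  · obtain ⟨x, y, z, rfl⟩ : ∃ x y z, v = ![x, y, z] :=
      ⟨v 0, v 1, v 2, by ext i; fin_cases i <;> rfl⟩
    simp only [Set.mem_union, or_assoc]
    have h245 : x ≤ 0 → z ≤ 0 → x + z ≤ y →
        ![x, y, z] ∈ cone3 ![0, 1, 0] ![0, -1, -1] ![-1, -1, 0] := fun _ _ _ =>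
      mem_cone3_of_coords (l := y - x - z) (p := -z) (q := -x)
        (by linarith) (by linarith) (by linarith)
        (by simp) (by simp) (by simp)
    have h235 : x ≤ 0 → 0 ≤ z → x ≤ y →
        ![x, y, z] ∈ cone3 ![0, 1, 0] ![0, 0, 1] ![-1, -1, 0] := fun _ _ _ =>
      mem_cone3_of_coords (l := y - x) (p := z) (q := -x)
        (by linarith) (by linarith) (by linarith)
        (by simp) (by simp) (by simp)
    have h145 : z ≤ 0 → y ≤ z → y ≤ x + z →
        ![x, y, z] ∈ cone3 ![1, 0, 0] ![0, -1, -1] ![-1, -1, 0] := fun _ _ _ =>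
      mem_cone3_of_coords (l := x + z - y) (p := -z) (q := z - y)
        (by linarith) (by linarith) (by linarith)
        (by simp) (by simp) (by simp)
    have h135 : y ≤ 0 → 0 ≤ z → y ≤ x →
        ![x, y, z] ∈ cone3 ![1, 0, 0] ![0, 0, 1] ![-1, -1, 0] := fun _ _ _ =>
      mem_cone3_of_coords (l := x - y) (p := z) (q := -y)
        (by linarith) (by linarith) (by linarith)
        (by simp) (by simp) (by simp)
    have h246 : 0 ≤ x → z ≤ x → x + z ≤ y →
        ![x, y, z] ∈ cone3 ![0, 1, 0] ![0, -1, -1] ![1, 2, 1] := fun _ _ _ =>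
      mem_cone3_of_coords (l := y - x - z) (p := x - z) (q := x)
        (by linarith) (by linarith) (by linarith)
        (by simp) (by simp; ring) (by simp)
    have h236 : 0 ≤ x → x ≤ z → 2 * x ≤ y →
        ![x, y, z] ∈ cone3 ![0, 1, 0] ![0, 0, 1] ![1, 2, 1] := fun _ _ _ =>
      mem_cone3_of_coords (l := y - 2 * x) (p := z - x) (q := x)
        (by linarith) (by linarith) (by linarith)
        (by simp) (by simp; ring) (by simp)
    have h146 : z ≤ y → 2 * z ≤ y → y ≤ x + z →
        ![x, y, z] ∈ cone3 ![1, 0, 0] ![0, -1, -1] ![1, 2, 1] := fun _ _ _ =>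
      mem_cone3_of_coords (l := x - y + z) (p := y - 2 * z) (q := y - z)
        (by linarith) (by linarith) (by linarith)
        (by simp) (by simp; ring) (by simp; ring)
    have h136 : 0 ≤ y → y ≤ 2 * x → y ≤ 2 * z →
        ![x, y, z] ∈ cone3 ![1, 0, 0] ![0, 0, 1] ![1, 2, 1] := fun _ _ _ =>
      mem_cone3_of_coords (l := x - y / 2) (p := z - y / 2) (q := y / 2)
        (by linarith) (by linarith) (by linarith)
        (by simp) (by simp) (by simp)
    grind
  · refine ⟨?_, ?_, ?_, ?_, ?_, ?_, ?_, ?_⟩ <;>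
      exact linearIndependent_of_det_ne_zero (by simp [Matrix.det_fin_three] <;> norm_num)
end
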